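/- arXiv:1211.6246 — 2 statements merged into one kernel-verified Lean document; each statement's English description precedes it below -/
import Mathlib

section
/- Let n ≥ 1 and let Λ be a lattice of full rank in ℝ^n. Assume B ≥ 8 n^{n/2} · ν(Λ) and B₁ ≥ 8 n² (n+1) B. Let X be the set of (2n+1)-tuples whose first n entries lie in Λ ∩ [0,B)^n and whose last n+1 entries lie in Λ ∩ [0,B₁)^n, and let Z ⊆ X be the subset of tuples whose entries generate Λ as a ℤ-module. Then |Z| ≥ α_n · |X|, where α_n := (∏_{i=2}^{n+1} ζ(i)^{-1} − 1/4) · ∏_{k=0}^{n-1} (1 − n^{k/2} (4 n^{n/2} + 1)^k / (4 n^{n/2} − 1)^n), and moreover α_n ≥ 0.092. -/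
/-- The real Riemann zeta value `ζ(i) = ∑_{k=1}^∞ k^{-i}`. -/
noncomputable def zetaR (i : ℕ) : ℝ := ∑' k : ℕ, 1 / (k + 1 : ℝ) ^ i

/-- The covering radius of a lattice: the supremum over `x` of the distance from `x`
to the nearest lattice point. -/
noncomputable def covRad {n : ℕ} (Λ : Submodule ℤ (EuclideanSpace ℝ (Fin n))) : ℝ :=
  ⨆ x : EuclideanSpace ℝ (Fin n), Metric.infDist x (Λ : Set (EuclideanSpace ℝ (Fin n)))

/-- The half-open cube `[0, B)^n`. -/
def cube (n : ℕ) (B : ℝ) : Set (EuclideanSpace ℝ (Fin n)) :=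
  {x | ∀ i, 0 ≤ x i ∧ x i < B}

section Zeta

theorem summable_zetaR {i : ℕ} (hi : 2 ≤ i) : Summable fun k : ℕ => 1 / (k + 1 : ℝ) ^ i := by
  have h := (summable_nat_add_iff 1).2 (Real.summable_one_div_nat_pow.2 (show 1 < i by omega))
  simpa using h

theorem zetaR_two : zetaR 2 = Real.pi ^ 2 / 6 := by
  have h := (hasSum_nat_add_iff' 1).2 hasSum_zeta_two
  simpa [zetaR] using h.tsum_eq

theorem one_le_zetaR {i : ℕ} (hi : 2 ≤ i) : 1 ≤ zetaR i := by
  have h := (summable_zetaR hi).le_tsum 0 (fun j _ => by positivity)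
  simpa [zetaR] using h

theorem zetaR_split {i : ℕ} (hi : 2 ≤ i) :
    zetaR i = 1 + 1 / 2 ^ i + 1 / 3 ^ i + ∑' k : ℕ, 1 / (k + 4 : ℝ) ^ i := by
  have h := (summable_zetaR hi).sum_add_tsum_nat_add 3
  rw [zetaR, ← h]
  simp only [Finset.sum_range_succ, Finset.sum_range_zero]
  norm_num [add_assoc]

/-- Comparing the tail of `ζ(i)` with that of `ζ(2)`. -/
theorem zetaR_le {i : ℕ} (hi : 2 ≤ i) :
    zetaR i ≤ 1 + 1 / 2 ^ i + 1 / 3 ^ i + 0.29 / 4 ^ (i - 2) := by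
  have hs : ∀ {j : ℕ}, 2 ≤ j → Summable fun k : ℕ => 1 / (k + 4 : ℝ) ^ j := fun {j} hj => by
    have := (summable_nat_add_iff 3).2 (summable_zetaR hj)
    refine this.congr fun k => ?_
    push_cast
    ring_nf
  have h2 : ∑' k : ℕ, 1 / (k + 4 : ℝ) ^ 2 ≤ 0.29 := by
    have h := zetaR_split le_rfl
    rw [zetaR_two] at h
    have := Real.pi_lt_d4
    have := Real.pi_pos
    nlinarith
  have h3 : ∑' k : ℕ, 1 / (k + 4 : ℝ) ^ i ≤ ∑' k : ℕ, 1 / (k + 4 : ℝ) ^ 2 * (1 / 4 ^ (i - 2)) := by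
    refine (hs hi).tsum_le_tsum (fun k => ?_) ((hs le_rfl).mul_right _)
    obtain ⟨j, rfl⟩ := Nat.exists_eq_add_of_le hi
    rw [Nat.add_sub_cancel_left, pow_add, ← one_div_mul_one_div]
    gcongr
    linarith [Nat.cast_nonneg (α := ℝ) k]
  rw [tsum_mul_right] at h3
  rw [zetaR_split hi]
  have h4 : (∑' k : ℕ, 1 / (k + 4 : ℝ) ^ 2) * (1 / 4 ^ (i - 2)) ≤ 0.29 * (1 / 4 ^ (i - 2)) := by
    gcongr
  rw [mul_one_div (0.29 : ℝ)] at h4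
  linarith

theorem zetaR_le_one_add {i : ℕ} (hi : 6 ≤ i) : zetaR i ≤ 1 + 2 / 2 ^ i := by
  have h := zetaR_le (show 2 ≤ i by omega)
  obtain ⟨j, rfl⟩ := Nat.exists_eq_add_of_le hi
  have e : 6 + j - 2 = j + 4 := by omega
  rw [e] at h
  have h3 : (1 : ℝ) / 3 ^ (6 + j) ≤ 1 / 2 ^ j * (1 / 3 ^ 6) := by
    rw [pow_add, ← one_div_mul_one_div, mul_comm]
    gcongr
    norm_num
  have h4 : (0.29 : ℝ) / 4 ^ (j + 4) ≤ 1 / 2 ^ j * (0.29 / 4 ^ 4) := by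
    rw [pow_add, ← div_div, div_right_comm, div_eq_mul_one_div _ (4 ^ j), mul_comm]
    gcongr
    norm_num
  have e2 : (1 : ℝ) / 2 ^ (6 + j) = 1 / 2 ^ j * (1 / 2 ^ 6) := by
    rw [pow_add, ← one_div_mul_one_div, mul_comm]
  have e3 : (2 : ℝ) / 2 ^ (6 + j) = 2 * (1 / 2 ^ (6 + j)) := by ring
  rw [e3, e2]
  rw [e2] at h
  have : (0 : ℝ) < (2 ^ j)⁻¹ := by positivity
  norm_num at h h3 h4 ⊢
  linarith

theorem prod_zetaR_le_aux (j : ℕ) :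
    ∏ i ∈ Finset.Icc 2 (j + 5), zetaR i ≤ 2.5 * (1 - 2 / 2 ^ (j + 5)) := by
  induction j with
  | zero =>
    have e : Finset.Icc 2 (0 + 5) = {2, 3, 4, 5} := by decide
    rw [e, Finset.prod_insert (by decide), Finset.prod_insert (by decide),
      Finset.prod_insert (by decide), Finset.prod_singleton]
    have h2 : zetaR 2 ≤ 1.645 := by
      rw [zetaR_two]
      nlinarith [Real.pi_lt_d4, Real.pi_pos]
    have h3 := zetaR_le (show 2 ≤ 3 by norm_num)
    have h4 := zetaR_le (show 2 ≤ 4 by norm_num)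
    have h5 := zetaR_le (show 2 ≤ 5 by norm_num)
    have p3 := one_le_zetaR (show 2 ≤ 3 by norm_num)
    have p4 := one_le_zetaR (show 2 ≤ 4 by norm_num)
    have p5 := one_le_zetaR (show 2 ≤ 5 by norm_num)
    have h3' : zetaR 3 ≤ 1.235 := h3.trans (by norm_num)
    have h4' : zetaR 4 ≤ 1.093 := h4.trans (by norm_num)
    have h5' : zetaR 5 ≤ 1.04 := h5.trans (by norm_num)
    calc zetaR 2 * (zetaR 3 * (zetaR 4 * zetaR 5)) ≤ 1.645 * (1.235 * (1.093 * 1.04)) := by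
          gcongr
      _ ≤ _ := by norm_num
  | succ j ih =>
    rw [show j + 1 + 5 = (j + 5) + 1 by ring, Finset.prod_Icc_succ_top (by omega)]
    have hz := zetaR_le_one_add (show 6 ≤ j + 5 + 1 by omega)
    have hx : (2 : ℝ) / 2 ^ (j + 5) = 2 * (2 / 2 ^ (j + 5 + 1)) := by
      rw [pow_succ]; ring
    have hpos : (0 : ℝ) < 2 / 2 ^ (j + 5 + 1) := by positivity
    have h1 := one_le_zetaR (show 2 ≤ j + 5 + 1 by omega)
    rw [hx] at ih
    have hQ : 0 ≤ ∏ i ∈ Finset.Icc 2 (j + 5), zetaR i := Finset.prod_nonneg fun i hi =>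
      zero_le_one.trans (one_le_zetaR (Finset.mem_Icc.1 hi).1)
    set x : ℝ := 2 / 2 ^ (j + 5 + 1)
    nlinarith [mul_le_mul ih hz (by linarith) (by linarith)]

theorem prod_zetaR_le (n : ℕ) : ∏ i ∈ Finset.Icc 2 (n + 1), zetaR i ≤ 2.5 := by
  have h : ∏ i ∈ Finset.Icc 2 (n + 1), zetaR i ≤ ∏ i ∈ Finset.Icc 2 (n + 5), zetaR i := by
    apply Finset.prod_le_prod_of_subset_of_one_le
    · exact Finset.Icc_subset_Icc_right (by omega)
    · exact fun i hi => zero_le_one.trans (one_le_zetaR (Finset.mem_Icc.1 hi).1)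
    · exact fun i hi _ => one_le_zetaR (Finset.mem_Icc.1 hi).1
  refine h.trans ((prod_zetaR_le_aux n).trans ?_)
  have : (0 : ℝ) < 2 / 2 ^ (n + 5) := by positivity
  linarith

theorem le_prod_inv_zetaR (n : ℕ) : 0.4 ≤ ∏ i ∈ Finset.Icc 2 (n + 1), (zetaR i)⁻¹ := by
  rw [Finset.prod_inv_distrib]
  have hpos : 0 < ∏ i ∈ Finset.Icc 2 (n + 1), zetaR i := Finset.prod_pos fun i hi =>
    zero_lt_one.trans_le (one_le_zetaR (Finset.mem_Icc.1 hi).1)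
  rw [le_inv_comm₀ (by norm_num) hpos]
  exact (prod_zetaR_le n).trans (by norm_num)

theorem prod_inv_zetaR_le {n : ℕ} (hn : 1 ≤ n) :
    ∏ i ∈ Finset.Icc 2 (n + 1), (zetaR i)⁻¹ ≤ 4 / 5 := by
  have h : ∏ i ∈ Finset.Icc 2 (n + 1), (zetaR i)⁻¹ ≤ ∏ i ∈ {2}, (zetaR i)⁻¹ := by
    apply Finset.prod_le_prod_of_subset_of_le_one
    · simpa using hn
    · exact fun i hi => inv_nonneg.2 (zero_le_one.trans (one_le_zetaR (Finset.mem_Icc.1 hi).1))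
    · exact fun i hi _ => inv_le_one_of_one_le₀ (one_le_zetaR (Finset.mem_Icc.1 hi).1)
  refine h.trans ?_
  rw [Finset.prod_singleton, zetaR_two, inv_le_comm₀ (by positivity) (by norm_num)]
  nlinarith [Real.pi_gt_three]

/-- The Euler product, as a lower bound for its finite partial products. -/
theorem inv_zetaR_le_prod_primes (S : Finset ℕ) (hS : ∀ p ∈ S, p.Prime) {j : ℕ} (hj : 2 ≤ j) :
    (zetaR j)⁻¹ ≤ ∏ p ∈ S, (1 - 1 / (p : ℝ) ^ j) := by
  let f : ℕ →* ℝ :=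
    { toFun := fun m => 1 / (m : ℝ) ^ j
      map_one' := by simp
      map_mul' := fun a b => by push_cast; rw [mul_pow, one_div_mul_one_div] }
  have hf : Summable f := Real.summable_one_div_nat_pow.2 (show 1 < j by omega)
  have h := EulerProduct.prod_filter_prime_geometric_eq_tsum_factoredNumbers hf S
  rw [Finset.filter_true_of_mem hS] at h
  have hz : zetaR j = ∑' m, f m := by
    rw [hf.tsum_eq_zero_add, zetaR]
    have : f 0 = 0 := by simp [f, show j ≠ 0 by omega]
    rw [this, zero_add]
    exact tsum_congr fun k => by simp [f]
  have hle : ∏ p ∈ S, (1 - f p)⁻¹ ≤ zetaR j := by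
    rw [h, hz]
    exact hf.tsum_subtype_le _ _ fun m => by simp only [f, MonoidHom.coe_mk, OneHom.coe_mk]; positivity
  have hpos : 0 < ∏ p ∈ S, (1 - f p) := by
    refine Finset.prod_pos fun p hp => ?_
    have h1 : (1 : ℝ) < (p : ℝ) ^ j :=
      one_lt_pow₀ (by exact_mod_cast (hS p hp).one_lt) (by omega)
    have : f p < 1 := by
      simp only [f, MonoidHom.coe_mk, OneHom.coe_mk]
      rw [div_lt_one (by linarith)]
      exact h1
    linarith
  rw [Finset.prod_inv_distrib] at hle
  exact inv_le_of_inv_le₀ hpos hle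

end Zeta

section Constants

theorem one_sub_sum_le_prod_one_sub {n : ℕ} (c : ℕ → ℝ) (h0 : ∀ k < n, 0 ≤ c k)
    (h1 : ∀ k < n, c k ≤ 1) :
    1 - ∑ k ∈ Finset.range n, c k ≤ ∏ k ∈ Finset.range n, (1 - c k) := by
  induction n with
  | zero => simp
  | succ n ih =>
    rw [Finset.sum_range_succ, Finset.prod_range_succ]
    have h := ih (fun k hk => h0 k (by omega)) (fun k hk => h1 k (by omega))
    have hs : 0 ≤ ∑ k ∈ Finset.range n, c k :=
      Finset.sum_nonneg fun k hk => h0 k ((Finset.mem_range.1 hk).trans n.lt_succ_self)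
    nlinarith [h0 n n.lt_succ_self, h1 n n.lt_succ_self]

/-- The bound for the proportion of lattice points of a large cube lying on a given subspace of
dimension `k`. -/
noncomputable def subspaceProportion (n k : ℕ) : ℝ :=
  (n : ℝ) ^ ((k : ℝ) / 2) * (4 * (n : ℝ) ^ ((n : ℝ) / 2) + 1) ^ k /
    (4 * (n : ℝ) ^ ((n : ℝ) / 2) - 1) ^ n

theorem natCast_rpow_half (n k : ℕ) : (n : ℝ) ^ ((k : ℝ) / 2) = √n ^ k := by
  rw [Real.sqrt_eq_rpow, ← Real.rpow_natCast, ← Real.rpow_mul (Nat.cast_nonneg n)]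
  ring_nf

theorem subspaceProportion_eq (n k : ℕ) :
    subspaceProportion n k = √n ^ k * (4 * √n ^ n + 1) ^ k / (4 * √n ^ n - 1) ^ n := by
  rw [subspaceProportion, natCast_rpow_half, natCast_rpow_half]

theorem one_le_sqrt_natCast {n : ℕ} (hn : 1 ≤ n) : 1 ≤ √(n : ℝ) :=
  Real.one_le_sqrt.2 (by exact_mod_cast hn)

theorem subspaceProportion_nonneg {n : ℕ} (hn : 1 ≤ n) (k : ℕ) : 0 ≤ subspaceProportion n k := by
  rw [subspaceProportion_eq]
  have hm : 1 ≤ √(n : ℝ) ^ n := one_le_pow₀ (one_le_sqrt_natCast hn)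
  have : 0 ≤ 4 * √(n : ℝ) ^ n - 1 := by linarith
  positivity

theorem sum_subspaceProportion_le {n : ℕ} (hn : 1 ≤ n) :
    ∑ k ∈ Finset.range n, subspaceProportion n k ≤ 0.36 := by
  simp only [subspaceProportion_eq]
  obtain rfl | hn2 : n = 1 ∨ 2 ≤ n := by omega
  · norm_num
  set s := √(n : ℝ) with hs
  have hs1 : 1.4 ≤ s := by
    rw [hs]
    apply Real.le_sqrt_of_sq_le
    have : (2 : ℝ) ≤ n := by exact_mod_cast hn2
    linarith
  have hss : s ^ 2 = n := Real.sq_sqrt (Nat.cast_nonneg n)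
  set m := s ^ n with hm
  have hnm : (n : ℝ) ≤ m := by
    rw [← hss, hm]
    exact pow_le_pow_right₀ (by linarith) hn2
  have hn2' : (2 : ℝ) ≤ n := by exact_mod_cast hn2
  set q := s * (4 * m + 1) with hq
  have hq1 : 1 < q := by nlinarith
  have hD : 0 < (4 * m - 1) ^ n := pow_pos (by linarith) n
  have hratio : (4 * m + 1) ^ n ≤ 2 * (4 * m - 1) ^ n := by
    have hb := one_add_mul_le_pow (a := -(2 / (4 * m + 1))) (by
      rw [neg_le_neg_iff, div_le_iff₀] <;> linarith) n
    have e : 1 + -(2 / (4 * m + 1)) = (4 * m - 1) / (4 * m + 1) := by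
      have : (4 * m + 1) ≠ 0 := by linarith
      field_simp
      ring
    rw [e, div_pow] at hb
    have h2 : 1 / 2 ≤ 1 + (n : ℝ) * -(2 / (4 * m + 1)) := by
      have : (n : ℝ) * (2 / (4 * m + 1)) ≤ 1 / 2 := by
        rw [mul_div_assoc', div_le_iff₀] <;> linarith
      linarith
    have h3 := h2.trans hb
    rw [div_le_div_iff₀ (by norm_num) (pow_pos (by linarith) n)] at h3
    linarith
  have hsum : ∑ k ∈ Finset.range n, s ^ k * (4 * m + 1) ^ k / (4 * m - 1) ^ n
      = (q ^ n - 1) / (q - 1) / (4 * m - 1) ^ n := by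
    rw [← Finset.sum_div, ← geom_sum_eq hq1.ne']
    simp only [hq, mul_pow]
  rw [hsum, div_div, div_le_iff₀ (mul_pos (by linarith) hD)]
  have hqn : q ^ n ≤ m * (2 * (4 * m - 1) ^ n) := by
    rw [hq, mul_pow, ← hm]
    gcongr
  have hmq : 2 * m ≤ 0.36 * (q - 1) := by
    rw [hq]; nlinarith
  nlinarith

theorem subspaceProportion_le_one {n k : ℕ} (hk : k < n) : subspaceProportion n k ≤ 1 := by
  have hn : 1 ≤ n := by omega
  have h := Finset.single_le_sum (f := subspaceProportion n)
    (fun i _ => subspaceProportion_nonneg hn i) (Finset.mem_range.2 hk)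
  linarith [sum_subspaceProportion_le hn]

theorem le_prod_one_sub_subspaceProportion {n : ℕ} (hn : 1 ≤ n) :
    0.64 ≤ ∏ k ∈ Finset.range n, (1 - subspaceProportion n k) := by
  have h := one_sub_sum_le_prod_one_sub (subspaceProportion n)
    (fun k _ => subspaceProportion_nonneg hn k) (fun k hk => subspaceProportion_le_one hk)
  linarith [sum_subspaceProportion_le hn]

end Constants

section GeneratingTuples

/-- If all fibres of `f` on `W` have `c` elements, then all fibres of the induced map on
`ι`-tuples have `c ^ card ι` elements. -/
theorem card_piFinset_filter_comp_mem {ι α β : Type*} [Fintype ι] [DecidableEq ι] (W : Finset α)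
    (f : α → β) [∀ b, DecidablePred (f · = b)] (c : ℕ) (hc : ∀ b, (W.filter (f · = b)).card = c)
    (T : Finset (ι → β)) [DecidablePred fun w : ι → α => f ∘ w ∈ T] :
    ((Fintype.piFinset fun _ : ι => W).filter (fun w => f ∘ w ∈ T)).card
      = c ^ Fintype.card ι * T.card := by
  classical
  have hmaps : Set.MapsTo (fun w : ι → α => f ∘ w)
      (((Fintype.piFinset fun _ : ι => W).filter (fun w => f ∘ w ∈ T) : Finset (ι → α)) :
        Set (ι → α)) (T : Set (ι → β)) :=
    fun w hw => by
      rw [Finset.mem_coe, Finset.mem_filter] at hw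
      exact hw.2
  rw [Finset.card_eq_sum_card_fiberwise hmaps]
  rw [Finset.sum_congr rfl (g := fun _ => c ^ Fintype.card ι), Finset.sum_const, smul_eq_mul,
    mul_comm]
  intro t ht
  have : ((Fintype.piFinset fun _ : ι => W).filter (fun w => f ∘ w ∈ T)).filter (fun w => f ∘ w = t)
      = Fintype.piFinset fun i => W.filter (f · = t i) := by
    ext w
    simp only [Finset.mem_filter, Fintype.mem_piFinset]
    constructor
    · rintro ⟨⟨h1, -⟩, rfl⟩ i
      exact ⟨h1 i, rfl⟩
    · intro h
      have e : f ∘ w = t := funext fun i => (h i).2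
      exact ⟨⟨fun i => (h i).1, e ▸ ht⟩, e⟩
  rw [this, Fintype.card_piFinset, Finset.prod_congr rfl (fun i _ => hc (t i)), Finset.prod_const,
    Finset.card_univ]

theorem prod_le_card_spanning {K V : Type*} [Field K] [Fintype K] [AddCommGroup V] [Module K V]
    [Finite V] {k : ℕ} (hk : Module.finrank K V ≤ k) :
    ∏ i : Fin (Module.finrank K V), (Fintype.card K ^ k - Fintype.card K ^ (i : ℕ)) ≤
      Nat.card {t : Fin k → V // Submodule.span K (Set.range t) = ⊤} := by
  have : Module.Finite K V := Module.Finite.of_finite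
  let b := Module.finBasis K V
  have h := card_linearIndependent (K := K) (V := Fin k → K) (k := Module.finrank K V)
    (by simpa using hk)
  rw [Module.finrank_fin_fun] at h
  rw [← h]
  refine Nat.card_le_card_of_injective
    (fun s => ⟨fun j => b.equivFun.symm fun i => s.1 i j, ?_⟩) ?_
  · let M : Matrix (Fin (Module.finrank K V)) (Fin k) K := Matrix.of s.1
    have hr : M.rank = Module.finrank K V := by
      rw [LinearIndependent.rank_matrix (M := M) s.2, Fintype.card_fin]
    rw [Matrix.rank_eq_finrank_span_cols] at hr
    have ht : Submodule.span K (Set.range M.col) = ⊤ :=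
      Submodule.eq_top_of_finrank_eq (by rw [hr, Module.finrank_fin_fun])
    have e : Set.range (fun j => b.equivFun.symm fun i => s.1 i j)
        = b.equivFun.symm '' Set.range M.col := by
      rw [← Set.range_comp]
      rfl
    rw [e]
    erw [← Submodule.map_span b.equivFun.symm.toLinearMap]
    rw [ht, Submodule.map_top]
    exact LinearEquiv.range _
  · intro s s' hss
    ext i j
    have h1 := congrFun (congrArg Subtype.val hss) j
    exact congrFun (b.equivFun.symm.injective h1) i

theorem prod_mul_le_card_spanning {p n : ℕ} [Fact p.Prime] {V : Type*} [AddCommGroup V]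
    [Module (ZMod p) V] [Finite V] (hn : Module.finrank (ZMod p) V ≤ n) :
    (∏ j ∈ Finset.Icc 2 (n + 1), (1 - 1 / (p : ℝ) ^ j)) * (Nat.card V : ℝ) ^ (n + 1) ≤
      Nat.card {t : Fin (n + 1) → V // Submodule.span (ZMod p) (Set.range t) = ⊤} := by
  have h := prod_le_card_spanning (K := ZMod p) (V := V) (hn.trans n.le_succ)
  refine le_trans ?_ (Nat.cast_le.2 h)
  have hp : (1 : ℝ) < p := by exact_mod_cast (Fact.out : p.Prime).one_lt
  have hp0 : (p : ℝ) ≠ 0 := by linarith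
  rw [ZMod.card, Module.natCard_eq_pow_finrank (K := ZMod p), Nat.card_zmod]
  set r := Module.finrank (ZMod p) V
  have e1 : ((∏ i : Fin r, (p ^ (n + 1) - p ^ (i : ℕ)) : ℕ) : ℝ)
      = (∏ i ∈ Finset.range r, (1 - 1 / (p : ℝ) ^ (n + 1 - i))) * ((p ^ r : ℕ) : ℝ) ^ (n + 1) := by
    rw [Fin.prod_univ_eq_prod_range (fun i => p ^ (n + 1) - p ^ i) r, Nat.cast_prod]
    have : ((p ^ r : ℕ) : ℝ) ^ (n + 1) = ∏ i ∈ Finset.range r, (p : ℝ) ^ (n + 1) := by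
      rw [Finset.prod_const, Finset.card_range, Nat.cast_pow, ← pow_mul, ← pow_mul, mul_comm]
    rw [this, ← Finset.prod_mul_distrib]
    refine Finset.prod_congr rfl fun i hi => ?_
    have hi' : i ≤ n + 1 := by have := Finset.mem_range.1 hi; omega
    rw [Nat.cast_sub (Nat.pow_le_pow_right (Fact.out : p.Prime).pos hi')]
    push_cast
    obtain ⟨d, hd⟩ := Nat.exists_eq_add_of_le hi'
    rw [hd, Nat.add_sub_cancel_left, pow_add]
    field_simp
  rw [e1]
  gcongr
  have hterm : ∀ m : ℕ, 1 ≤ m → 0 ≤ 1 - 1 / (p : ℝ) ^ m := fun m _ => by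
    rw [sub_nonneg, div_le_one (by positivity)]
    exact one_le_pow₀ hp.le
  have e2 : ∏ j ∈ Finset.Icc 2 (n + 1), (1 - 1 / (p : ℝ) ^ j)
      = ∏ i ∈ Finset.range n, (1 - 1 / (p : ℝ) ^ (n + 1 - i)) := by
    refine Finset.prod_nbij' (fun j => n + 1 - j) (fun i => n + 1 - i) ?_ ?_ ?_ ?_ ?_
    · intro j hj; simp only [Finset.mem_Icc, Finset.mem_range] at *; omega
    · intro j hj; simp only [Finset.mem_Icc, Finset.mem_range] at *; omega
    · intro j hj; simp only [Finset.mem_Icc] at *; omega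
    · intro j hj; simp only [Finset.mem_range] at *; omega
    · intro j hj
      simp only [Finset.mem_Icc] at hj
      rw [show n + 1 - (n + 1 - j) = j by omega]
  rw [e2]
  apply Finset.prod_le_prod_of_subset_of_le_one
  · exact Finset.range_subset_range.2 hn
  · intro i hi
    exact hterm _ (by have := Finset.mem_range.1 hi; omega)
  · intro i hi _
    have : 0 ≤ 1 / (p : ℝ) ^ (n + 1 - i) := by positivity
    linarith

/-- The subgroup `pG` of an abelian group. -/
abbrev multiples (G : Type*) [AddCommGroup G] (p : ℕ) : AddSubgroup G :=
  (nsmulAddMonoidHom p : G →+ G).range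

theorem closure_eq_top_iff_span_zmod {V : Type*} [AddCommGroup V] {p : ℕ} [Module (ZMod p) V]
    (s : Set V) : AddSubgroup.closure s = ⊤ ↔ Submodule.span (ZMod p) s = ⊤ := by
  have : Submodule.span (ZMod p) s = AddSubgroup.toZModSubmodule p (AddSubgroup.closure s) := by
    apply le_antisymm
    · rw [Submodule.span_le]
      exact AddSubgroup.subset_closure
    · intro x hx
      have : AddSubgroup.closure s ≤ (Submodule.span (ZMod p) s).toAddSubgroup :=
        (AddSubgroup.closure_le _).2 Submodule.subset_span
      exact this hx
  rw [this, map_eq_top_iff]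

theorem prod_mul_le_card_generating {G V : Type*} [AddCommGroup G] [AddCommGroup V] [Finite V]
    {n p : ℕ} [Fact p.Prime] [Module (ZMod p) V] (f : G →+ V) (hf : Function.Surjective f)
    (g : Fin n → G) (hg : AddSubgroup.closure (Set.range g) = ⊤) :
    (∏ j ∈ Finset.Icc 2 (n + 1), (1 - 1 / (p : ℝ) ^ j)) * (Nat.card V : ℝ) ^ (n + 1) ≤
      Nat.card {t : Fin (n + 1) → V // AddSubgroup.closure (Set.range t) = ⊤} := by
  simp only [closure_eq_top_iff_span_zmod (p := p)]
  apply prod_mul_le_card_spanning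
  have hq : Submodule.span (ZMod p) (Set.range (f ∘ g)) = ⊤ := by
    rw [← closure_eq_top_iff_span_zmod, Set.range_comp, ← AddMonoidHom.map_closure, hg,
      ← AddMonoidHom.range_eq_map]
    exact AddMonoidHom.range_eq_top.2 hf
  have := finrank_range_le_card (R := ZMod p) (f ∘ g)
  rwa [Set.finrank, hq, finrank_top, Fintype.card_fin] at this

theorem prod_mul_le_card_generating_quotient {G : Type*} [AddCommGroup G] [Finite G] {n p : ℕ}
    (hp : p.Prime) (g : Fin n → G) (hg : AddSubgroup.closure (Set.range g) = ⊤) :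
    (∏ j ∈ Finset.Icc 2 (n + 1), (1 - 1 / (p : ℝ) ^ j)) *
        (Nat.card (G ⧸ multiples G p) : ℝ) ^ (n + 1) ≤
      Nat.card {t : Fin (n + 1) → G ⧸ multiples G p // AddSubgroup.closure (Set.range t) = ⊤} := by
  have : Fact p.Prime := ⟨hp⟩
  let _ : Module (ZMod p) (G ⧸ multiples G p) := QuotientAddGroup.zmodModule fun x => ⟨x, rfl⟩
  exact prod_mul_le_card_generating (p := p) (QuotientAddGroup.mk' (multiples G p))
    (QuotientAddGroup.mk'_surjective _) g hg

/-- A tuple generates a finite abelian group as soon as it does so modulo all primes. -/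
theorem closure_eq_top_of_forall_prime {G : Type*} [AddCommGroup G] [Finite G] {ι : Type*}
    (t : ι → G) (h : ∀ p ∈ (Nat.card G).primeFactors,
      AddSubgroup.closure (Set.range fun i => (t i : G ⧸ multiples G p)) = ⊤) :
    AddSubgroup.closure (Set.range t) = ⊤ := by
  set H := AddSubgroup.closure (Set.range t) with hH
  by_contra hne
  have hcard : Nat.card (G ⧸ H) ≠ 1 := fun h1 => hne (AddSubgroup.index_eq_one.1 h1)
  obtain ⟨p, hp, hdvd⟩ := Nat.exists_prime_and_dvd hcard
  have : Fact p.Prime := ⟨hp⟩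
  have hpG : p ∈ (Nat.card G).primeFactors := by
    refine Nat.mem_primeFactors.2 ⟨hp, hdvd.trans ?_, Nat.card_pos.ne'⟩
    exact AddSubgroup.card_quotient_dvd_card H
  have hsurj : ∀ x : G, ∃ y ∈ H, ∃ z, y + p • z = x := fun x => by
    have hx : (x : G ⧸ multiples G p) ∈ AddSubgroup.closure
        (Set.range fun i => (t i : G ⧸ multiples G p)) := by
      rw [h p hpG]; trivial
    have e : Set.range (fun i => (t i : G ⧸ multiples G p))
        = QuotientAddGroup.mk' (multiples G p) '' Set.range t := Set.range_comp _ t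
    rw [e, ← AddMonoidHom.map_closure] at hx
    obtain ⟨y, hy, hyx⟩ := hx
    obtain ⟨z, hz⟩ := (QuotientAddGroup.eq (s := multiples G p)).1 hyx
    refine ⟨y, hy, z, ?_⟩
    change p • z = _ at hz
    rw [hz]; abel
  have hs : Function.Surjective fun x : G ⧸ H => p • x := by
    intro x
    induction x using QuotientAddGroup.induction_on with
    | H x =>
      obtain ⟨y, hy, z, rfl⟩ := hsurj x
      refine ⟨(z : G ⧸ H), ?_⟩
      change ((p • z : G) : G ⧸ H) = _
      rw [QuotientAddGroup.eq]
      simpa using hy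
  obtain ⟨x, hx⟩ := exists_prime_addOrderOf_dvd_card' p hdvd
  have hinj := Finite.injective_iff_surjective.2 hs
  have : x = 0 := hinj (by simp only [smul_zero]; rw [← hx, addOrderOf_nsmul_eq_zero])
  rw [this, addOrderOf_zero] at hx
  exact hp.one_lt.ne hx

/-- The Chinese remainder theorem for the quotients `G ⧸ pG`. -/
theorem surjective_quotient_multiples {G : Type*} [AddCommGroup G] (S : Finset ℕ)
    (hS : ∀ p ∈ S, p.Prime) :
    Function.Surjective fun (x : G) (p : S) => (x : G ⧸ multiples G p) := by
  intro y
  choose z hz using fun p => QuotientAddGroup.mk_surjective (y p)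
  have hc : ∀ p : S, ∃ c : ℕ, (∃ d : ℤ, (c : ℤ) = 1 + p * d) ∧ ∀ q : S, q ≠ p → (q : ℕ) ∣ c := by
    intro p
    have hcop : (∏ q ∈ S.erase p, q).Coprime p := Nat.Coprime.prod_left fun q hq =>
      (Nat.coprime_primes (hS q (Finset.mem_of_mem_erase hq)) (hS p p.2)).2 (Finset.ne_of_mem_erase hq)
    obtain ⟨m, -, hm⟩ := Nat.exists_mul_mod_eq_one_of_coprime hcop (hS p p.2).one_lt
    refine ⟨(∏ q ∈ S.erase p, q) * m, ⟨(((∏ q ∈ S.erase p, q) * m / p : ℕ) : ℤ), ?_⟩, fun q hq => ?_⟩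
    · have := Nat.mod_add_div ((∏ q ∈ S.erase p, q) * m) p
      rw [hm] at this
      exact_mod_cast this.symm
    · exact (Finset.dvd_prod_of_mem (fun q => q)
        (Finset.mem_erase.2 ⟨fun h => hq (Subtype.ext h), q.2⟩)).mul_right m
  choose c hc1 hc2 using hc
  refine ⟨∑ p, c p • z p, funext fun p => ?_⟩
  rw [← hz p]
  refine (QuotientAddGroup.eq (s := multiples G p)).2 ?_
  rw [← Finset.add_sum_erase _ _ (Finset.mem_univ p)]
  obtain ⟨d, hd⟩ := hc1 p
  have e : -(c p • z p + ∑ q ∈ Finset.univ.erase p, c q • z q) + z p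
      = -((p : ℕ) • (d • z p)) - ∑ q ∈ Finset.univ.erase p, c q • z q := by
    have : c p • z p = z p + (p : ℕ) • (d • z p) := by
      rw [← natCast_zsmul, hd, add_smul, one_smul, mul_smul, natCast_zsmul]
    rw [this]; abel
  rw [e]
  refine sub_mem (neg_mem ⟨_, rfl⟩) (sum_mem fun q hq => ?_)
  obtain ⟨k, hk⟩ := hc2 q p (Finset.ne_of_mem_erase hq).symm
  exact ⟨k • z q, by rw [hk, mul_smul]; rfl⟩

open scoped Classical in
/-- `n + 1` uniformly random elements generate a finite abelian group of rank at most `n` with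
probability at least `∏ ζ(i)⁻¹`. -/
theorem prod_inv_zetaR_mul_le_card_generating {G : Type*} [AddCommGroup G] [Finite G] {n : ℕ}
    (g : Fin n → G) (hg : AddSubgroup.closure (Set.range g) = ⊤) :
    (∏ i ∈ Finset.Icc 2 (n + 1), (zetaR i)⁻¹) * (Nat.card G : ℝ) ^ (n + 1) ≤
      Nat.card {t : Fin (n + 1) → G // AddSubgroup.closure (Set.range t) = ⊤} := by
  have := Fintype.ofFinite G
  set S := (Nat.card G).primeFactors with hSdef
  have hS : ∀ p ∈ S, p.Prime := fun p hp => (Nat.mem_primeFactors.1 hp).1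
  let V : S → Type _ := fun p => G ⧸ multiples G p
  have hVfin : ∀ p, Fintype (V p) := fun p => Fintype.ofFinite _
  let φ : G →+ ∀ p, V p := AddMonoidHom.pi fun p => QuotientAddGroup.mk' (multiples G p)
  have hφ : Function.Surjective φ := surjective_quotient_multiples S hS
  let T : Finset (Fin (n + 1) → ∀ p, V p) :=
    Finset.univ.filter fun t => ∀ p, AddSubgroup.closure (Set.range fun i => t i p) = ⊤
  set c := (Finset.univ.filter fun x : G => φ x = 0).card with hc
  have hfib : ∀ y, (Finset.univ.filter (φ · = y)).card = c := fun y =>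
    AddMonoidHom.card_fiber_eq_of_mem_range φ (hφ y) (hφ 0)
  have hG : Nat.card G = c * ∏ p, Nat.card (V p) := by
    rw [Nat.card_eq_fintype_card, ← Finset.card_univ, Finset.card_eq_sum_card_fiberwise (f := φ)
      (t := Finset.univ) (fun _ _ => Finset.mem_univ _), Finset.sum_congr rfl (fun y _ => hfib y),
      Finset.sum_const, smul_eq_mul, mul_comm, Finset.card_univ, ← Nat.card_eq_fintype_card,
      Nat.card_pi]
  have hT : T.card =
      ∏ p, Nat.card {t : Fin (n + 1) → V p // AddSubgroup.closure (Set.range t) = ⊤} := by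
    rw [← Nat.card_pi, ← Fintype.card_subtype, ← Nat.card_eq_fintype_card]
    exact Nat.card_congr <| ((Equiv.piComm fun (_ : Fin (n + 1)) p => V p).subtypeEquiv
      (q := fun t => ∀ p, AddSubgroup.closure (Set.range (t p)) = ⊤) fun t => Iff.rfl).trans
        (Equiv.subtypePiEquivPi
          (p := fun p (t : Fin (n + 1) → V p) => AddSubgroup.closure (Set.range t) = ⊤))
  have hcount := card_piFinset_filter_comp_mem (ι := Fin (n + 1)) Finset.univ φ c hfib T
  have hle : ((Fintype.piFinset fun _ : Fin (n + 1) => (Finset.univ : Finset G)).filter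
      (fun w => φ ∘ w ∈ T)).card ≤
      Nat.card {t : Fin (n + 1) → G // AddSubgroup.closure (Set.range t) = ⊤} := by
    rw [Nat.card_eq_fintype_card, Fintype.card_subtype]
    refine Finset.card_le_card fun w hw => ?_
    simp only [Finset.mem_filter, Finset.mem_univ, true_and, T] at hw ⊢
    exact closure_eq_top_of_forall_prime w fun p hp => hw.2 ⟨p, hp⟩
  rw [hcount, hT, Fintype.card_fin] at hle
  refine le_trans ?_ (Nat.cast_le.2 hle)
  rw [hG]
  push_cast
  rw [mul_pow, mul_left_comm, ← Finset.prod_pow]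
  refine mul_le_mul_of_nonneg_left ?_ (by positivity)
  calc (∏ i ∈ Finset.Icc 2 (n + 1), (zetaR i)⁻¹) * ∏ p, (Nat.card (V p) : ℝ) ^ (n + 1)
      ≤ (∏ p : S, ∏ j ∈ Finset.Icc 2 (n + 1), (1 - 1 / ((p : ℕ) : ℝ) ^ j)) *
          ∏ p, (Nat.card (V p) : ℝ) ^ (n + 1) := by
        refine mul_le_mul_of_nonneg_right ?_ (Finset.prod_nonneg fun _ _ => by positivity)
        rw [Finset.prod_comm]
        refine Finset.prod_le_prod (fun i hi => ?_) fun i hi => ?_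
        · exact inv_nonneg.2 (zero_le_one.trans (one_le_zetaR (Finset.mem_Icc.1 hi).1))
        · rw [Finset.prod_coe_sort S fun p => 1 - 1 / (p : ℝ) ^ i]
          exact inv_zetaR_le_prod_primes S hS (Finset.mem_Icc.1 hi).1
    _ = ∏ p : S, (∏ j ∈ Finset.Icc 2 (n + 1), (1 - 1 / ((p : ℕ) : ℝ) ^ j)) *
          (Nat.card (V p) : ℝ) ^ (n + 1) := Finset.prod_mul_distrib.symm
    _ ≤ _ := by
        refine Finset.prod_le_prod (fun p _ => ?_) fun p _ =>
          prod_mul_le_card_generating_quotient (hS p p.2) g hg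
        refine mul_nonneg (Finset.prod_nonneg fun j _ => ?_) (by positivity)
        have hp : (1 : ℝ) ≤ (p : ℕ) := by exact_mod_cast (hS p p.2).one_lt.le
        rw [sub_nonneg, div_le_one (by positivity)]
        exact one_le_pow₀ hp

end GeneratingTuples

section Voronoi

open MeasureTheory

variable {E : Type*} [NormedAddCommGroup E]

/-- The closed Voronoi cell of `Λ` at the origin. -/
def closedVoronoi (Λ : Submodule ℤ E) : Set E := {x | ∀ l ∈ Λ, ‖x‖ ≤ ‖x - l‖}

/-- The points strictly closer to the origin than to any other point of `Λ`. -/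
def openVoronoi (Λ : Submodule ℤ E) : Set E := {x | ∀ l ∈ Λ, l ≠ 0 → ‖x‖ < ‖x - l‖}

theorem openVoronoi_subset_closedVoronoi (Λ : Submodule ℤ E) :
    openVoronoi Λ ⊆ closedVoronoi Λ := by
  intro x hx l hl
  by_cases h : l = 0
  · simp [h]
  · exact (hx l hl h).le

theorem norm_le_of_mem_closedVoronoi {Λ : Submodule ℤ E} {ν : ℝ}
    (hν : ∀ x : E, ∃ l ∈ Λ, ‖x - l‖ ≤ ν) {x : E} (hx : x ∈ closedVoronoi Λ) : ‖x‖ ≤ ν := by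
  obtain ⟨l, hl, h⟩ := hν x
  exact (hx l hl).trans h

/-- Translates of the open Voronoi cell by distinct lattice points are disjoint. -/
theorem eq_of_sub_mem_openVoronoi {Λ : Submodule ℤ E} {x l l' : E} (hl : l ∈ Λ) (hl' : l' ∈ Λ)
    (h : x - l ∈ openVoronoi Λ) (h' : x - l' ∈ openVoronoi Λ) : l = l' := by
  by_contra hne
  have h1 := h (l' - l) (sub_mem hl' hl) (sub_ne_zero.2 (Ne.symm hne))
  have h2 := h' (l - l') (sub_mem hl hl') (sub_ne_zero.2 hne)
  rw [sub_sub_sub_cancel_right] at h1 h2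
  exact lt_asymm h1 h2

theorem isClosed_coe_of_discrete (Λ : Submodule ℤ E) [DiscreteTopology Λ] :
    IsClosed (Λ : Set E) := by
  have : DiscreteTopology Λ.toAddSubgroup := ‹_›
  exact AddSubgroup.isClosed_of_discrete (H := Λ.toAddSubgroup)

variable [InnerProductSpace ℝ E] [FiniteDimensional ℝ E]

theorem volume_openVoronoi_lt_top [MeasurableSpace E] [BorelSpace E] (Λ : Submodule ℤ E) {ν : ℝ}
    (hν : ∀ x : E, ∃ l ∈ Λ, ‖x - l‖ ≤ ν) :
    volume (openVoronoi Λ) < ⊤ := by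
  have : ProperSpace E := FiniteDimensional.proper ℝ E
  refine (measure_mono fun x hx => ?_).trans_lt
    (isCompact_closedBall (0 : E) ν).measure_lt_top
  rw [mem_closedBall_zero_iff]
  exact norm_le_of_mem_closedVoronoi hν (openVoronoi_subset_closedVoronoi Λ hx)

variable (Λ : Submodule ℤ E) [DiscreteTopology Λ]

theorem exists_mem_infDist_eq (x : E) : ∃ l ∈ Λ, Metric.infDist x Λ = ‖x - l‖ := by
  have : ProperSpace E := FiniteDimensional.proper ℝ E
  obtain ⟨l, hl, h⟩ := (isClosed_coe_of_discrete Λ).exists_infDist_eq_dist ⟨0, Λ.zero_mem⟩ x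
  exact ⟨l, hl, by rw [h, dist_eq_norm]⟩

theorem exists_sub_mem_closedVoronoi (x : E) : ∃ l ∈ Λ, x - l ∈ closedVoronoi Λ := by
  obtain ⟨l, hl, h⟩ := exists_mem_infDist_eq Λ x
  refine ⟨l, hl, fun l' hl' => ?_⟩
  rw [← h, sub_sub, ← dist_eq_norm]
  exact Metric.infDist_le_dist_of_mem (add_mem hl hl')

theorem countable_coe_of_discrete : (Λ : Set E).Countable := by
  have : ProperSpace E := FiniteDimensional.proper ℝ E
  exact Set.countable_coe_iff.1 (TopologicalSpace.separableSpace_iff_countable.1 inferInstance)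

variable [MeasurableSpace E] [BorelSpace E]

theorem volume_preimage_sub_right (s : E) (A : Set E) :
    volume ((fun x => x - s) ⁻¹' A) = volume A := by
  simp only [sub_eq_add_neg, measure_preimage_add_right]

theorem measurableSet_openVoronoi : MeasurableSet (openVoronoi Λ) := by
  have : openVoronoi Λ = ⋂ l ∈ (Λ : Set E), {x | l ≠ 0 → ‖x‖ < ‖x - l‖} := by
    ext x; simp [openVoronoi]
  rw [this]
  refine MeasurableSet.biInter (countable_coe_of_discrete Λ) fun l _ => ?_
  by_cases h : l = 0
  · simp [h]
  · simp only [ne_eq, h, not_false_eq_true, forall_const]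
    exact (isOpen_lt continuous_norm (by fun_prop)).measurableSet

theorem volume_closedVoronoi : volume (closedVoronoi Λ) = volume (openVoronoi Λ) := by
  refine le_antisymm ?_ (measure_mono (openVoronoi_subset_closedVoronoi Λ))
  have hsub : closedVoronoi Λ ⊆ openVoronoi Λ ∪
      ⋃ l ∈ (Λ : Set E) \ {0}, (AffineSubspace.perpBisector (0 : E) l : Set E) := by
    intro x hx
    by_cases h : x ∈ openVoronoi Λ
    · exact Or.inl h
    · right
      simp only [openVoronoi, Set.mem_ofPred_eq, not_forall, not_lt] at h
      obtain ⟨l, hl, h0, hle⟩ := h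
      refine Set.mem_biUnion (x := l) ⟨hl, h0⟩ ?_
      rw [SetLike.mem_coe, AffineSubspace.mem_perpBisector_iff_dist_eq, dist_zero_right,
        dist_eq_norm]
      exact le_antisymm (hx l hl) hle
  refine (measure_mono hsub).trans ((measure_union_le _ _).trans ?_)
  rw [(measure_biUnion_null_iff ((countable_coe_of_discrete Λ).mono Set.sdiff_subset)).2, add_zero]
  intro l hl
  refine Measure.addHaar_affineSubspace _ _ ?_
  rw [Ne, AffineSubspace.perpBisector_eq_top]
  exact fun h => hl.2 h.symm

/-- Packing: translates of the cell by points of `S` contained in `T`. -/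
theorem card_mul_volume_le {S : Finset E} (hS : ∀ s ∈ S, s ∈ Λ) {T : Set E}
    (hT : ∀ s ∈ S, ∀ x ∈ closedVoronoi Λ, s + x ∈ T) :
    S.card * volume (openVoronoi Λ) ≤ volume T := by
  have hmeas : ∀ s ∈ S, MeasurableSet ((fun x => x - s) ⁻¹' openVoronoi Λ) := fun s _ =>
    (measurableSet_openVoronoi Λ).preimage (by fun_prop)
  have hdisj : (S : Set E).PairwiseDisjoint fun s => (fun x => x - s) ⁻¹' openVoronoi Λ := by
    intro s hs s' hs' hne
    refine Set.disjoint_left.2 fun x hx hx' => hne ?_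
    exact eq_of_sub_mem_openVoronoi (hS s hs) (hS s' hs') hx hx'
  have h := measure_biUnion_finset (μ := volume) hdisj hmeas
  simp only [volume_preimage_sub_right, Finset.sum_const, nsmul_eq_mul] at h
  rw [← h]
  refine measure_mono (Set.iUnion₂_subset fun s hs x hx => ?_)
  simpa using hT s hs _ (openVoronoi_subset_closedVoronoi Λ hx)

/-- Covering: translates of the cell by points of `S` covering `T`. -/
theorem volume_le_card_mul {S : Finset E} {T : Set E}
    (hT : ∀ x ∈ T, ∀ l ∈ Λ, x - l ∈ closedVoronoi Λ → l ∈ S) :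
    volume T ≤ S.card * volume (openVoronoi Λ) := by
  have hsub : T ⊆ ⋃ s ∈ S, (fun x => x - s) ⁻¹' closedVoronoi Λ := by
    intro x hx
    obtain ⟨l, hl, h⟩ := exists_sub_mem_closedVoronoi Λ x
    exact Set.mem_biUnion (hT x hx l hl h) h
  refine (measure_mono hsub).trans ((measure_biUnion_finset_le _ _).trans ?_)
  simp only [volume_preimage_sub_right, Finset.sum_const, nsmul_eq_mul, volume_closedVoronoi,
    le_refl]

theorem volume_openVoronoi_pos : 0 < volume (openVoronoi Λ) := by
  rw [pos_iff_ne_zero, ← volume_closedVoronoi]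
  intro h0
  have hsub : (Set.univ : Set E) ⊆ ⋃ s ∈ (Λ : Set E), (fun x => x - s) ⁻¹' closedVoronoi Λ := by
    intro x _
    obtain ⟨l, hl, h⟩ := exists_sub_mem_closedVoronoi Λ x
    exact Set.mem_biUnion hl h
  have : volume (Set.univ : Set E) = 0 := by
    refine measure_mono_null hsub ((measure_biUnion_null_iff (countable_coe_of_discrete Λ)).2 ?_)
    intro s _
    rw [volume_preimage_sub_right, h0]
  exact NeZero.ne (volume : Measure E) (Measure.measure_univ_eq_zero.1 this)

theorem volume_orthonormal_box {ι : Type*} [Fintype ι] (e : OrthonormalBasis ι ℝ E) (s : ι → Set ℝ)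
    (hs : ∀ i, MeasurableSet (s i)) :
    volume {x | ∀ i, inner ℝ (e i) x ∈ s i} = ∏ i, volume (s i) := by
  rw [← volume_pi_pi, ← (PiLp.volume_preserving_ofLp ι).measure_preimage
    (MeasurableSet.univ_pi hs).nullMeasurableSet, ← e.measurePreserving_repr.measure_preimage]
  · congr 1
    ext x
    simp [OrthonormalBasis.repr_apply_apply]
  · exact ((MeasurableSet.univ_pi hs).preimage
      (PiLp.volume_preserving_ofLp ι).measurable).nullMeasurableSet

end Voronoi

section LatticePoints

open MeasureTheory

variable {n : ℕ}

theorem norm_apply_le_of_norm_le {x : EuclideanSpace ℝ (Fin n)} {r : ℝ} (h : ‖x‖ ≤ r) (i : Fin n) :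
    |x i| ≤ r := (PiLp.norm_apply_le x i).trans h

theorem volume_box (s : Set ℝ) (hs : MeasurableSet s) :
    volume {x : EuclideanSpace ℝ (Fin n) | ∀ i, x i ∈ s} = volume s ^ n := by
  have h := volume_orthonormal_box (EuclideanSpace.basisFun (Fin n) ℝ) (fun _ => s) fun _ => hs
  simpa [EuclideanSpace.inner_single_left] using h

theorem norm_sub_center_le {B : ℝ} (hB : 0 ≤ B) {x : EuclideanSpace ℝ (Fin n)} (hx : x ∈ cube n B) :
    ‖x - WithLp.toLp 2 (fun _ => B / 2)‖ ≤ √n * B / 2 := by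
  rw [EuclideanSpace.norm_eq]
  have : √n * B / 2 = √(n * (B / 2) ^ 2) := by
    rw [Real.sqrt_mul (Nat.cast_nonneg n), Real.sqrt_sq (by linarith)]
    ring
  rw [this]
  apply Real.sqrt_le_sqrt
  calc _ ≤ ∑ _i : Fin n, (B / 2) ^ 2 := by
        refine Finset.sum_le_sum fun i _ => ?_
        have := hx i
        rw [PiLp.sub_apply, Real.norm_eq_abs, sq_abs]
        exact sq_le_sq' (by linarith) (by linarith)
    _ = _ := by simp

variable (Λ : Submodule ℤ (EuclideanSpace ℝ (Fin n))) [DiscreteTopology Λ] [IsZLattice ℝ Λ]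

theorem exists_norm_sub_le_covRad (x : EuclideanSpace ℝ (Fin n)) :
    ∃ l ∈ Λ, ‖x - l‖ ≤ covRad Λ := by
  obtain ⟨l, hl, h⟩ := exists_mem_infDist_eq Λ x
  refine ⟨l, hl, h ▸ le_ciSup (f := fun x => Metric.infDist x (Λ : Set (EuclideanSpace ℝ (Fin n))))
    ?_ x⟩
  have : Module.Free ℤ Λ := ZLattice.module_free ℝ Λ
  have : Module.Finite ℤ Λ := ZLattice.module_finite ℝ Λ
  let b := (Module.finBasis ℤ Λ).ofZLatticeBasis ℝ Λ
  refine ⟨∑ i, ‖b i‖, ?_⟩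
  rintro _ ⟨y, rfl⟩
  have hmem : (ZSpan.floor b y : EuclideanSpace ℝ (Fin n)) ∈ Λ := by
    have hsp := (Module.finBasis ℤ Λ).ofZLatticeBasis_span ℝ
    exact hsp.le (ZSpan.floor b y).2
  refine (Metric.infDist_le_dist_of_mem hmem).trans ?_
  rw [dist_eq_norm]
  exact ZSpan.norm_fract_le b y

theorem covRad_pos (hn : 1 ≤ n) : 0 < covRad Λ := by
  by_contra hle
  have hsub : (Set.univ : Set (EuclideanSpace ℝ (Fin n))) ⊆ Λ := by
    intro x _
    obtain ⟨l, hl, h⟩ := exists_norm_sub_le_covRad Λ x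
    have : ‖x - l‖ = 0 := le_antisymm (h.trans (not_lt.1 hle)) (norm_nonneg _)
    rw [norm_sub_eq_zero_iff] at this
    exact this ▸ hl
  have : Nonempty (Fin n) := ⟨⟨0, hn⟩⟩
  have hc := (countable_coe_of_discrete Λ).mono hsub
  exact NeZero.ne (volume : Measure (EuclideanSpace ℝ (Fin n)))
    (Measure.measure_univ_eq_zero.1 (hc.measure_zero _))

/-- The volume of the Voronoi cell. -/
noncomputable def cellVolume (Λ : Submodule ℤ (EuclideanSpace ℝ (Fin n))) : ℝ :=
  (volume (openVoronoi Λ)).toReal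

theorem cellVolume_pos : 0 < cellVolume Λ :=
  ENNReal.toReal_pos (volume_openVoronoi_pos Λ).ne'
    (volume_openVoronoi_lt_top Λ (exists_norm_sub_le_covRad Λ)).ne

theorem ofReal_cellVolume : ENNReal.ofReal (cellVolume Λ) = volume (openVoronoi Λ) :=
  ENNReal.ofReal_toReal (volume_openVoronoi_lt_top Λ (exists_norm_sub_le_covRad Λ)).ne

theorem pow_le_card_mul_cellVolume {a b : ℝ} (hab : 0 ≤ b - a - 2 * covRad Λ)
    {S : Finset (EuclideanSpace ℝ (Fin n))} (hS : ∀ l ∈ Λ, (∀ i, a ≤ l i ∧ l i < b) → l ∈ S) :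
    (b - a - 2 * covRad Λ) ^ n ≤ S.card * cellVolume Λ := by
  have h := volume_le_card_mul Λ (S := S)
    (T := {x | ∀ i, x i ∈ Set.Ioo (a + covRad Λ) (b - covRad Λ)}) (by
      intro x hx l hl hc
      refine hS l hl fun i => ?_
      have h1 := norm_apply_le_of_norm_le
        (norm_le_of_mem_closedVoronoi (exists_norm_sub_le_covRad Λ) hc) i
      have h2 := hx i
      rw [PiLp.sub_apply, abs_le] at h1
      exact ⟨by linarith [h2.1], by linarith [h2.2]⟩)
  rw [volume_box _ measurableSet_Ioo, Real.volume_Ioo, ← ofReal_cellVolume,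
    ← ENNReal.ofReal_natCast, ← ENNReal.ofReal_mul (Nat.cast_nonneg _),
    ← ENNReal.ofReal_pow (by linarith), ENNReal.ofReal_le_ofReal_iff
      (mul_nonneg (Nat.cast_nonneg _) (cellVolume_pos Λ).le)] at h
  convert h using 2
  ring

theorem card_mul_cellVolume_le {B : ℝ} (hB : 0 ≤ B) (hν : 0 ≤ covRad Λ)
    {S : Finset (EuclideanSpace ℝ (Fin n))} (hS : ∀ l ∈ S, l ∈ Λ ∧ l ∈ cube n B) :
    S.card * cellVolume Λ ≤ (B + 2 * covRad Λ) ^ n := by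
  have h := card_mul_volume_le Λ (S := S) (fun s hs => (hS s hs).1)
    (T := {x | ∀ i, x i ∈ Set.Icc (-covRad Λ) (B + covRad Λ)}) (by
      intro s hs x hx i
      have h1 := norm_apply_le_of_norm_le
        (norm_le_of_mem_closedVoronoi (exists_norm_sub_le_covRad Λ) hx) i
      have h2 := (hS s hs).2 i
      rw [abs_le] at h1
      rw [PiLp.add_apply]
      exact ⟨by linarith [h2.1], by linarith [h2.2]⟩)
  rw [volume_box _ measurableSet_Icc, Real.volume_Icc, ← ofReal_cellVolume,
    ← ENNReal.ofReal_natCast, ← ENNReal.ofReal_mul (Nat.cast_nonneg _),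
    ← ENNReal.ofReal_pow (by linarith), ENNReal.ofReal_le_ofReal_iff
      (pow_nonneg (by linarith) _)] at h
  convert h using 2
  ring

theorem card_span_mul_cellVolume_le {B : ℝ} (hB : 0 ≤ B) (hν : 0 ≤ covRad Λ) {k : ℕ} (hk : k ≤ n)
    (v : Fin k → EuclideanSpace ℝ (Fin n)) {S : Finset (EuclideanSpace ℝ (Fin n))}
    (hS : ∀ l ∈ S, l ∈ Λ ∧ l ∈ cube n B ∧ l ∈ Submodule.span ℝ (Set.range v)) :
    S.card * cellVolume Λ ≤ (√n * B + 2 * covRad Λ) ^ k * (2 * covRad Λ) ^ (n - k) := by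
  let f : Fin n → EuclideanSpace ℝ (Fin n) := fun i => if h : (i : ℕ) < k then v ⟨i, h⟩ else 0
  let e := InnerProductSpace.gramSchmidtOrthonormalBasis (𝕜 := ℝ)
    (show Module.finrank ℝ (EuclideanSpace ℝ (Fin n)) = Fintype.card (Fin n) by simp) f
  have horth : ∀ j : Fin n, k ≤ (j : ℕ) → ∀ x ∈ Submodule.span ℝ (Set.range v),
      inner ℝ (e j) x = 0 := by
    intro j hj x hx
    induction hx using Submodule.span_induction with
    | mem x hx =>
      obtain ⟨i, rfl⟩ := hx
      have h := InnerProductSpace.gramSchmidtOrthonormalBasis_inv_triangular (𝕜 := ℝ)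
        (show Module.finrank ℝ (EuclideanSpace ℝ (Fin n)) = Fintype.card (Fin n) by simp) f
        (i := Fin.castLE hk i) (j := j) (by
          rw [Fin.lt_def, Fin.val_castLE]; exact i.2.trans_le hj)
      simpa [f] using h
    | zero => simp
    | add x y _ _ hx hy => rw [inner_add_right, hx, hy, add_zero]
    | smul a x _ hx => rw [inner_smul_right, hx, mul_zero]
  set z : EuclideanSpace ℝ (Fin n) := WithLp.toLp 2 (fun _ => B / 2)
  have hcs : ∀ j x, |inner ℝ (e j) x| ≤ ‖x‖ := fun j x => by
    have := abs_real_inner_le_norm (e j) x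
    rwa [e.orthonormal.1 j, one_mul] at this
  let s : Fin n → Set ℝ := fun j => if (j : ℕ) < k then
    Set.Icc (inner ℝ (e j) z - √n * B / 2 - covRad Λ) (inner ℝ (e j) z + √n * B / 2 + covRad Λ)
    else Set.Icc (-covRad Λ) (covRad Λ)
  have hs : ∀ j, MeasurableSet (s j) := fun j => by
    simp only [s]; split_ifs <;> exact measurableSet_Icc
  have h := card_mul_volume_le Λ (S := S) (fun l hl => (hS l hl).1)
    (T := {x | ∀ i, inner ℝ (e i) x ∈ s i}) (by
      intro l hl x hx j
      have hxν := (hcs j x).trans (norm_le_of_mem_closedVoronoi (exists_norm_sub_le_covRad Λ) hx)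
      rw [abs_le] at hxν
      rw [inner_add_right]
      simp only [s]
      split_ifs with hj
      · have h3 := (hcs j (l - z)).trans (norm_sub_center_le hB (hS l hl).2.1)
        rw [inner_sub_right, abs_le] at h3
        exact ⟨by linarith, by linarith⟩
      · rw [horth j (not_lt.1 hj) l (hS l hl).2.2, zero_add]
        exact hxν)
  have hvol : ∀ j, volume (s j) = ENNReal.ofReal
      (if (j : ℕ) < k then √n * B + 2 * covRad Λ else 2 * covRad Λ) := fun j => by
    simp only [s]
    split_ifs
    · rw [Real.volume_Icc]; congr 1; ring
    · rw [Real.volume_Icc]; congr 1; ring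
  have hpos : 0 ≤ √n * B + 2 * covRad Λ := by positivity
  rw [volume_orthonormal_box e s hs, Finset.prod_congr rfl (fun j _ => hvol j),
    ← ENNReal.ofReal_prod_of_nonneg (fun j _ => by split_ifs <;> linarith),
    ← ofReal_cellVolume, ← ENNReal.ofReal_natCast, ← ENNReal.ofReal_mul (Nat.cast_nonneg _),
    ENNReal.ofReal_le_ofReal_iff (Finset.prod_nonneg fun j _ => by split_ifs <;> linarith)] at h
  refine h.trans_eq ?_
  rw [Fin.prod_univ_eq_prod_range
    (fun j => if j < k then √n * B + 2 * covRad Λ else 2 * covRad Λ) n]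
  obtain ⟨d, rfl⟩ := Nat.exists_eq_add_of_le hk
  rw [Finset.prod_range_add, Finset.prod_congr rfl (g := fun _ => √↑(k + d) * B + 2 * covRad Λ),
    Finset.prod_congr (s₁ := Finset.range d) rfl (g := fun _ => 2 * covRad Λ)]
  · simp
  · intro j _; simp
  · intro j hj; simp [Finset.mem_range.1 hj]

/-- The proportion of the lattice points in a large cube which lie on a given subspace. -/
theorem card_span_le_subspaceProportion (hn : 1 ≤ n) {B : ℝ}
    (hB : 8 * √(n : ℝ) ^ n * covRad Λ ≤ B) {k : ℕ} (hk : k < n)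
    (v : Fin k → EuclideanSpace ℝ (Fin n)) {S D : Finset (EuclideanSpace ℝ (Fin n))}
    (hS : ∀ l ∈ S, l ∈ Λ ∧ l ∈ cube n B ∧ l ∈ Submodule.span ℝ (Set.range v))
    (hD : ∀ l ∈ Λ, l ∈ cube n B → l ∈ D) :
    S.card ≤ subspaceProportion n k * D.card := by
  have hν := covRad_pos Λ hn
  have hs := one_le_sqrt_natCast hn
  have hm : 1 ≤ √(n : ℝ) ^ n := one_le_pow₀ hs
  have hBν : 8 * covRad Λ ≤ B := by nlinarith
  have h1 := card_span_mul_cellVolume_le Λ (by linarith) hν.le hk.le v hS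
  have h2 := pow_le_card_mul_cellVolume Λ (a := 0) (b := B) (by linarith) (S := D) hD
  rw [sub_zero] at h2
  rw [subspaceProportion_eq]
  set ν := covRad Λ
  set m := √(n : ℝ) ^ n
  have hc := cellVolume_pos Λ
  set c := cellVolume Λ
  obtain ⟨t, ht⟩ : ∃ t, B = 2 * ν * t := ⟨B / (2 * ν), by field_simp⟩
  have htm : 4 * m ≤ t := by
    rw [ht] at hB
    have : (4 * m) * (2 * ν) ≤ t * (2 * ν) := by linarith
    exact le_of_mul_le_mul_right this (by linarith)
  have hkey : √(n : ℝ) ^ k * (t + 1) ^ k / (t - 1) ^ n ≤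
      √(n : ℝ) ^ k * (4 * m + 1) ^ k / (4 * m - 1) ^ n := by
    have hdec : (t + 1) * (4 * m - 1) ≤ (4 * m + 1) * (t - 1) := by nlinarith
    rw [div_le_div_iff₀ (pow_pos (by linarith) _) (pow_pos (by linarith) _), mul_assoc, mul_assoc]
    refine mul_le_mul_of_nonneg_left ?_ (by positivity)
    obtain ⟨d, rfl⟩ := Nat.exists_eq_add_of_le hk.le
    rw [pow_add, pow_add, ← mul_assoc, ← mul_assoc, ← mul_pow, ← mul_pow]
    refine mul_le_mul ?_ ?_ (pow_nonneg (by linarith) _) ?_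
    · exact pow_le_pow_left₀ (mul_nonneg (by linarith) (by linarith)) hdec _
    · exact pow_le_pow_left₀ (by linarith) (by linarith) _
    · exact pow_nonneg (mul_nonneg (by linarith) (by linarith)) _
  refine le_trans ?_ (mul_le_mul_of_nonneg_right hkey (Nat.cast_nonneg _))
  rw [div_mul_eq_mul_div, le_div_iff₀ (pow_pos (by linarith) _)]
  have h2' : (2 * ν) ^ n * (t - 1) ^ n ≤ D.card * c := by
    rw [← mul_pow]; convert h2 using 2; rw [ht]; ring
  have h1' : S.card * c ≤ (2 * ν) ^ n * (√(n : ℝ) ^ k * (t + 1) ^ k) := by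
    refine h1.trans ?_
    have e : (2 * ν) ^ n = (2 * ν) ^ k * (2 * ν) ^ (n - k) := by
      rw [← pow_add, Nat.add_sub_cancel' hk.le]
    rw [e, mul_right_comm, ← mul_pow, mul_comm, mul_comm _ ((2 * ν) ^ (n - k)), ← mul_pow]
    refine mul_le_mul_of_nonneg_left (pow_le_pow_left₀ (by
      have : 0 ≤ B := by linarith
      positivity) ?_ _) (by positivity)
    rw [ht]
    nlinarith
  have hpos : 0 < (2 * ν) ^ n * c := by positivity
  refine le_of_mul_le_mul_right ?_ hpos
  calc (S.card : ℝ) * (t - 1) ^ n * ((2 * ν) ^ n * c)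
      = (S.card * c) * ((2 * ν) ^ n * (t - 1) ^ n) := by ring
    _ ≤ ((2 * ν) ^ n * (√(n : ℝ) ^ k * (t + 1) ^ k)) * (D.card * c) :=
        mul_le_mul h1' h2' (mul_nonneg (by positivity) (pow_nonneg (by linarith) _)) (by
          have : 0 ≤ t + 1 := by linarith
          positivity)
    _ = _ := by ring

open scoped Classical in
/-- Counting linearly independent tuples of elements of `D`. -/
theorem prod_mul_pow_le_card_linearIndependent {K V : Type*} [DivisionRing K] [AddCommGroup V]
    [Module K V] (D : Finset V) (c : ℕ → ℝ) {m : ℕ} (hc : ∀ k < m, c k ≤ 1)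
    (hD : ∀ k < m, ∀ v : Fin k → V,
      ((D.filter (· ∈ Submodule.span K (Set.range v))).card : ℝ) ≤ c k * D.card) :
    (∏ k ∈ Finset.range m, (1 - c k)) * (D.card : ℝ) ^ m ≤
      ((Fintype.piFinset fun _ : Fin m => D).filter (fun v => LinearIndependent K v)).card := by
  induction m with
  | zero =>
    simp [Finset.filter_true_of_mem]
  | succ m ih =>
    have ih := ih (fun k hk => hc k (by omega)) (fun k hk => hD k (by omega))
    set L := (Fintype.piFinset fun _ : Fin m => D).filter (fun v => LinearIndependent K v) with hL
    have hle : (L.sigma fun v => D.filter (· ∉ Submodule.span K (Set.range v))).card ≤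
        ((Fintype.piFinset fun _ : Fin (m + 1) => D).filter (fun v => LinearIndependent K v)).card := by
      refine Finset.card_le_card_of_injOn (fun x => Fin.snoc (α := fun _ => V) x.1 x.2) ?_ ?_
      · rintro ⟨v, x⟩ hx
        simp only [Finset.coe_sigma, Set.mem_sigma_iff, Finset.mem_coe, hL, Finset.mem_filter,
          Fintype.mem_piFinset] at hx ⊢
        refine ⟨fun i => ?_, linearIndependent_finSnoc.2 ⟨hx.1.2, hx.2.2⟩⟩
        refine Fin.lastCases ?_ (fun i => ?_) i
        · simpa using hx.2.1
        · simpa using hx.1.1 i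
      · rintro ⟨v, x⟩ _ ⟨v', x'⟩ _ h
        obtain ⟨rfl, rfl⟩ := Fin.snoc_injective2 h
        rfl
    refine le_trans ?_ (Nat.cast_le.2 hle)
    rw [Finset.card_sigma, Nat.cast_sum, Finset.prod_range_succ, pow_succ]
    calc _ = ((∏ k ∈ Finset.range m, (1 - c k)) * (D.card : ℝ) ^ m) * ((1 - c m) * D.card) := by
          ring
      _ ≤ L.card * ((1 - c m) * D.card) := by
          refine mul_le_mul_of_nonneg_right ih (mul_nonneg ?_ (Nat.cast_nonneg _))
          linarith [hc m m.lt_succ_self]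
      _ = ∑ _v ∈ L, (1 - c m) * D.card := by rw [Finset.sum_const, nsmul_eq_mul]
      _ ≤ _ := by
          refine Finset.sum_le_sum fun v _ => ?_
          have h1 := hD m m.lt_succ_self v
          have h2 := Finset.card_filter_add_card_filter_not (s := D)
            (· ∈ Submodule.span K (Set.range v))
          have h3 : ((D.filter (· ∈ Submodule.span K (Set.range v))).card : ℝ) +
            (D.filter (· ∉ Submodule.span K (Set.range v))).card = D.card := by exact_mod_cast h2
          linarith

end LatticePoints

section Window

theorem sub_mul_pow_le_mul_pow {n : ℕ} (hn : 1 ≤ n) {B B₁ ν P : ℝ} (hν : 0 < ν) (hB : 8 * ν ≤ B)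
    (hB₁ : 8 * (n : ℝ) ^ 2 * ((n : ℝ) + 1) * B ≤ B₁) (hP : 0 ≤ P) (hP' : P ≤ 4 / 5) :
    (P - 1 / 4) * (B₁ + 2 * ν) ^ (n * (n + 1)) ≤
      P * (B₁ - 2 * n * B - 2 * ν) ^ (n * (n + 1)) := by
  have hn' : (1 : ℝ) ≤ n := by exact_mod_cast hn
  have hB0 : 0 < B := by linarith
  have hq : 0 < B₁ + 2 * ν := by
    have : 0 < 8 * (n : ℝ) ^ 2 * ((n : ℝ) + 1) * B := by positivity
    linarith
  set q := B₁ + 2 * ν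
  set ε := (2 * n * B + 4 * ν) / q with hε
  have he : B₁ - 2 * n * B - 2 * ν = (1 + -ε) * q := by
    rw [hε]; field_simp; simp only [q]; ring
  have hmε : (n * (n + 1) : ℝ) * ε ≤ 5 / 16 := by
    rw [hε, ← mul_div_assoc, div_le_iff₀ hq]
    have h1 : (n * (n + 1) : ℝ) * (2 * n * B + 4 * ν) ≤ n * (n + 1) * (5 / 2 * (n * B)) := by
      refine mul_le_mul_of_nonneg_left ?_ (by positivity)
      nlinarith
    have h2 : 5 / 16 * (8 * (n : ℝ) ^ 2 * ((n : ℝ) + 1) * B) ≤ 5 / 16 * q := by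
      simp only [q]; linarith
    linarith
  have hε2 : -2 ≤ -ε := by
    have h0 : 0 ≤ ε := by positivity
    nlinarith
  have hbern := one_add_mul_le_pow hε2 (n * (n + 1))
  push_cast at hbern
  rw [he, mul_pow, ← mul_assoc]
  refine mul_le_mul_of_nonneg_right ?_ (by positivity)
  have := mul_le_mul_of_nonneg_left (show (11 / 16 : ℝ) ≤ (1 + -ε) ^ (n * (n + 1)) by linarith) hP
  linarith

variable {n : ℕ}

theorem isBounded_cube (n : ℕ) (B : ℝ) : Bornology.IsBounded (cube n B) := by
  rcases le_or_gt 0 B with hB | hB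
  · refine (Metric.isBounded_closedBall (x := WithLp.toLp 2 (fun _ => B / 2))
      (r := √n * B / 2)).subset fun x hx => ?_
    rw [mem_closedBall_iff_norm]
    exact norm_sub_center_le hB hx
  · rcases Nat.eq_zero_or_pos n with rfl | hn
    · exact (Set.toFinite _).isBounded
    · refine Bornology.isBounded_empty.subset fun x hx => ?_
      have := hx ⟨0, hn⟩
      linarith

/-- The integral part with respect to a basis is invariant under adding a reduced vector. -/
theorem ZSpan_floor_add {ι E : Type*} [Fintype ι] [NormedAddCommGroup E] [NormedSpace ℝ E]
    (b : Module.Basis ι ℝ E) {u : E} (hu : u ∈ Submodule.span ℤ (Set.range b)) (y : E) :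
    (ZSpan.floor b (u + ZSpan.fract b y) : E) = ZSpan.floor b u := by
  have h1 : (ZSpan.floor b (u + ZSpan.fract b y) : E) =
      u + ZSpan.fract b y - ZSpan.fract b (u + ZSpan.fract b y) := by
    rw [ZSpan.fract_apply b (u + ZSpan.fract b y)]; abel
  rw [h1, ZSpan.fract_zSpan_add b _ hu, ZSpan.fract_fract, add_sub_cancel_right,
    ZSpan.floor_eq_self_of_mem b u hu]

theorem ZSpan_fract_apply_mem_Icc {B : ℝ}
    (b : Module.Basis (Fin n) ℝ (EuclideanSpace ℝ (Fin n))) (hb : ∀ i, b i ∈ cube n B)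
    (x : EuclideanSpace ℝ (Fin n)) (j : Fin n) :
    ZSpan.fract b x j ∈ Set.Icc 0 (n * B) := by
  have h : ZSpan.fract b x j = ∑ i, b.repr (ZSpan.fract b x) i * b i j := by
    conv_lhs => rw [← b.sum_repr (ZSpan.fract b x)]
    simp
  rw [h]
  simp only [ZSpan.repr_fract_apply]
  constructor
  · exact Finset.sum_nonneg fun i _ => mul_nonneg (Int.fract_nonneg _) (hb i j).1
  · refine (Finset.sum_le_card_nsmul Finset.univ _ B fun i _ => ?_).trans_eq (by simp)
    have h1 := Int.fract_lt_one (b.repr x i)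
    have h2 := hb i j
    nlinarith [h2.1, h2.2]

variable (Λ : Submodule ℤ (EuclideanSpace ℝ (Fin n)))

/-- The lattice points all of whose translates inside the same cell of the sublattice spanned
by `b` lie in the cube. -/
def window (b : Module.Basis (Fin n) ℝ (EuclideanSpace ℝ (Fin n))) (B₁ : ℝ) : Set Λ :=
  {x | ∀ y : Λ, (ZSpan.floor b (y : EuclideanSpace ℝ (Fin n)) : EuclideanSpace ℝ (Fin n)) =
    ZSpan.floor b (x : EuclideanSpace ℝ (Fin n)) → (y : EuclideanSpace ℝ (Fin n)) ∈ cube n B₁}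

variable {Λ} in
/-- The reduction of a lattice point modulo a sublattice. -/
noncomputable def reduce {b : Module.Basis (Fin n) ℝ (EuclideanSpace ℝ (Fin n))}
    (hb : Submodule.span ℤ (Set.range b) ≤ Λ) (y : Λ) : Λ :=
  ⟨ZSpan.fract b (y : EuclideanSpace ℝ (Fin n)), by
    rw [ZSpan.fract_apply]
    exact sub_mem y.2 (hb (ZSpan.floor b (y : EuclideanSpace ℝ (Fin n))).2)⟩

variable {b : Module.Basis (Fin n) ℝ (EuclideanSpace ℝ (Fin n))}

theorem mkQ_reduce (hb : Submodule.span ℤ (Set.range b) ≤ Λ) (y : Λ) :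
    ((Submodule.span ℤ (Set.range b)).submoduleOf Λ).mkQ (reduce hb y) =
      ((Submodule.span ℤ (Set.range b)).submoduleOf Λ).mkQ y := by
  rw [Submodule.mkQ_apply, Submodule.mkQ_apply, eq_comm, Submodule.Quotient.eq]
  change (y : EuclideanSpace ℝ (Fin n)) - ZSpan.fract b (y : EuclideanSpace ℝ (Fin n)) ∈
    Submodule.span ℤ (Set.range b)
  rw [ZSpan.fract_apply, sub_sub_cancel]
  exact (ZSpan.floor b (y : EuclideanSpace ℝ (Fin n))).2

theorem floor_add_reduce (hb : Submodule.span ℤ (Set.range b) ≤ Λ) {u : Λ}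
    (hu : u ∈ (Submodule.span ℤ (Set.range b)).submoduleOf Λ) (y : Λ) :
    (ZSpan.floor b ((u + reduce hb y : Λ) : EuclideanSpace ℝ (Fin n)) : EuclideanSpace ℝ (Fin n)) =
      ZSpan.floor b (u : EuclideanSpace ℝ (Fin n)) :=
  ZSpan_floor_add b hu _

theorem mem_window {B B₁ : ℝ} (hbB : ∀ i, b i ∈ cube n B) {x : Λ}
    (hx : ∀ i, n * B ≤ (x : EuclideanSpace ℝ (Fin n)) i ∧
      (x : EuclideanSpace ℝ (Fin n)) i < B₁ - n * B) : x ∈ window Λ b B₁ := by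
  intro y hy j
  have h1 := ZSpan_fract_apply_mem_Icc b hbB x j
  have h2 := ZSpan_fract_apply_mem_Icc b hbB y j
  rw [ZSpan.fract_apply, PiLp.sub_apply] at h1 h2
  rw [hy] at h2
  have h3 := hx j
  exact ⟨by linarith [h1.1, h1.2, h2.1, h2.2], by linarith [h1.1, h1.2, h2.1, h2.2]⟩

theorem span_union_range_eq (hb : Submodule.span ℤ (Set.range b) ≤ Λ) {m : ℕ} (w : Fin m → Λ)
    (hw : AddSubgroup.closure
      (Set.range (((Submodule.span ℤ (Set.range b)).submoduleOf Λ).mkQ ∘ w)) = ⊤) :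
    Submodule.span ℤ (Set.range b ∪ Set.range fun i => (w i : EuclideanSpace ℝ (Fin n))) = Λ := by
  refine le_antisymm ?_ fun x hx => ?_
  · rw [Submodule.span_union, sup_le_iff]
    refine ⟨hb, Submodule.span_le.2 ?_⟩
    rintro _ ⟨i, rfl⟩
    exact (w i).2
  · rw [Submodule.span_union]
    have h1 : ((Submodule.span ℤ (Set.range b)).submoduleOf Λ).mkQ ⟨x, hx⟩ ∈
        Submodule.span ℤ (Set.range (((Submodule.span ℤ (Set.range b)).submoduleOf Λ).mkQ ∘ w)) := by
      rw [← Submodule.mem_toAddSubgroup, Submodule.span_int_eq_addSubgroupClosure, hw]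
      trivial
    rw [Set.range_comp, Submodule.span_image] at h1
    obtain ⟨y, hy, hxy⟩ := h1
    rw [Submodule.mkQ_apply, Submodule.mkQ_apply, eq_comm, Submodule.Quotient.eq] at hxy
    have h2 : x - y ∈ Submodule.span ℤ (Set.range b) := hxy
    have h3 : (y : EuclideanSpace ℝ (Fin n)) ∈
        Submodule.span ℤ (Set.range fun i => (w i : EuclideanSpace ℝ (Fin n))) := by
      have := Submodule.mem_map_of_mem (f := Λ.subtype) hy
      rw [Submodule.map_span, ← Set.range_comp] at this
      exact this
    exact Submodule.mem_sup.2 ⟨_, h2, _, h3, sub_add_cancel _ _⟩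

variable [DiscreteTopology Λ]

theorem finite_inter_coe_of_isBounded {s : Set (EuclideanSpace ℝ (Fin n))}
    (hs : Bornology.IsBounded s) : (s ∩ Λ).Finite :=
  Metric.finite_isBounded_inter_isClosed (isDiscrete_iff_discreteTopology.2 inferInstance) hs
    (isClosed_coe_of_discrete Λ)

theorem finite_setOf_coe_mem_of_isBounded {s : Set (EuclideanSpace ℝ (Fin n))}
    (hs : Bornology.IsBounded s) : {x : Λ | (x : EuclideanSpace ℝ (Fin n)) ∈ s}.Finite := by
  refine Set.Finite.of_finite_image ((finite_inter_coe_of_isBounded Λ hs).subset ?_)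
    Subtype.val_injective.injOn
  rintro _ ⟨x, hx, rfl⟩
  exact ⟨hx, x.2⟩

theorem finite_window (b : Module.Basis (Fin n) ℝ (EuclideanSpace ℝ (Fin n)))
    (B₁ : ℝ) :
    (window Λ b B₁).Finite :=
  (finite_setOf_coe_mem_of_isBounded Λ (isBounded_cube n B₁)).subset fun x hx => hx x rfl

theorem finite_quotient_submoduleOf (hb : Submodule.span ℤ (Set.range b) ≤ Λ) :
    Finite (Λ ⧸ (Submodule.span ℤ (Set.range b)).submoduleOf Λ) := by
  have hfin := finite_setOf_coe_mem_of_isBounded Λ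
    (Metric.isBounded_closedBall (x := (0 : EuclideanSpace ℝ (Fin n))) (r := ∑ i, ‖b i‖))
  have := hfin.to_subtype
  refine Finite.of_surjective (fun x : {x : Λ | (x : EuclideanSpace ℝ (Fin n)) ∈
    Metric.closedBall (0 : EuclideanSpace ℝ (Fin n)) (∑ i, ‖b i‖)} =>
    ((Submodule.span ℤ (Set.range b)).submoduleOf Λ).mkQ x.1) fun γ => ?_
  obtain ⟨y, rfl⟩ := Submodule.mkQ_surjective _ γ
  refine ⟨⟨reduce hb y, ?_⟩, mkQ_reduce Λ hb y⟩
  rw [Set.mem_ofPred_eq, mem_closedBall_zero_iff]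
  exact ZSpan.norm_fract_le b _

open scoped Classical in
theorem card_window_filter_mkQ (hb : Submodule.span ℤ (Set.range b) ≤ Λ) (B₁ : ℝ)
    (γ : Λ ⧸ (Submodule.span ℤ (Set.range b)).submoduleOf Λ) :
    ((finite_window Λ b B₁).toFinset.filter
      (((Submodule.span ℤ (Set.range b)).submoduleOf Λ).mkQ · = γ)).card =
    ((finite_window Λ b B₁).toFinset.filter
      (((Submodule.span ℤ (Set.range b)).submoduleOf Λ).mkQ · = 0)).card := by
  obtain ⟨y, rfl⟩ := Submodule.mkQ_surjective _ γ
  refine Finset.card_nbij' (· - reduce hb y) (· + reduce hb y) ?_ ?_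
    (fun x _ => sub_add_cancel _ _) (fun x _ => add_sub_cancel_right _ _)
  · intro x hx
    simp only [Finset.coe_filter, Set.Finite.mem_toFinset, Set.mem_ofPred_eq] at hx ⊢
    have h0 : ((Submodule.span ℤ (Set.range b)).submoduleOf Λ).mkQ (x - reduce hb y) = 0 := by
      rw [map_sub, mkQ_reduce, hx.2, sub_self]
    refine ⟨fun z hz => hx.1 z ?_, h0⟩
    rw [Submodule.mkQ_apply, Submodule.Quotient.mk_eq_zero] at h0
    rw [hz, ← floor_add_reduce Λ hb h0 y, sub_add_cancel]
  · intro x hx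
    simp only [Finset.coe_filter, Set.Finite.mem_toFinset, Set.mem_ofPred_eq] at hx ⊢
    have h0 := hx.2
    rw [Submodule.mkQ_apply, Submodule.Quotient.mk_eq_zero] at h0
    refine ⟨fun z hz => hx.1 z ?_, ?_⟩
    · rw [hz, floor_add_reduce Λ hb h0 y]
    · rw [map_add, mkQ_reduce, hx.2, zero_add]

variable [IsZLattice ℝ Λ]

theorem exists_closure_range_mkQ_eq_top (M : Submodule ℤ Λ) :
    ∃ g : Fin n → Λ ⧸ M, AddSubgroup.closure (Set.range g) = ⊤ := by
  have : Module.Free ℤ Λ := ZLattice.module_free ℝ Λ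
  have : Module.Finite ℤ Λ := ZLattice.module_finite ℝ Λ
  have hrank : Module.finrank ℤ Λ = n := by
    rw [ZLattice.rank ℝ Λ, finrank_euclideanSpace_fin]
  let c := Module.finBasisOfFinrankEq ℤ Λ hrank
  refine ⟨M.mkQ ∘ c, ?_⟩
  rw [← Submodule.span_int_eq_addSubgroupClosure, Set.range_comp, Submodule.span_image, c.span_eq,
    Submodule.map_top, Submodule.range_mkQ, Submodule.top_toAddSubgroup]

open scoped Classical in
theorem prod_inv_zetaR_mul_card_window_le (hb : Submodule.span ℤ (Set.range b) ≤ Λ) (B₁ : ℝ) :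
    (∏ i ∈ Finset.Icc 2 (n + 1), (zetaR i)⁻¹) *
        ((finite_window Λ b B₁).toFinset.card : ℝ) ^ (n + 1) ≤
      ((Fintype.piFinset fun _ : Fin (n + 1) => (finite_window Λ b B₁).toFinset).filter fun w =>
        AddSubgroup.closure (Set.range
          (((Submodule.span ℤ (Set.range b)).submoduleOf Λ).mkQ ∘ w)) = ⊤).card := by
  set M := (Submodule.span ℤ (Set.range b)).submoduleOf Λ with hM
  have : Finite (Λ ⧸ M) := finite_quotient_submoduleOf Λ hb
  have := Fintype.ofFinite (Λ ⧸ M)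
  set W := (finite_window Λ b B₁).toFinset
  set c := (W.filter (M.mkQ · = 0)).card with hc
  have hfib : ∀ γ, (W.filter (M.mkQ · = γ)).card = c := card_window_filter_mkQ Λ hb B₁
  obtain ⟨g, hg⟩ := exists_closure_range_mkQ_eq_top Λ M
  have hgen := prod_inv_zetaR_mul_le_card_generating g hg
  have hW : W.card = Nat.card (Λ ⧸ M) * c := by
    rw [Finset.card_eq_sum_card_fiberwise (f := M.mkQ) (t := Finset.univ) (by simp),
      Finset.sum_congr rfl fun γ _ => hfib γ]
    simp [Nat.card_eq_fintype_card]
  have hcount := card_piFinset_filter_comp_mem (ι := Fin (n + 1)) W M.mkQ c hfib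
    (Finset.univ.filter fun t => AddSubgroup.closure (Set.range t) = ⊤)
  simp only [Finset.mem_filter, Finset.mem_univ, true_and] at hcount
  rw [hcount, Fintype.card_fin, hW]
  rw [Nat.card_eq_fintype_card (α := {t // _}), Fintype.card_subtype] at hgen
  push_cast
  rw [mul_pow, ← mul_assoc, mul_comm]
  exact mul_le_mul_of_nonneg_left hgen (by positivity)

open scoped Classical in
/-- Most tuples of lattice points in a large cube generate the lattice together with a given
linearly independent family of short lattice vectors. -/
theorem sub_mul_pow_le_card_generating (hn : 1 ≤ n) {B B₁ : ℝ} (hB : 8 * covRad Λ ≤ B)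
    (hB₁ : 8 * (n : ℝ) ^ 2 * ((n : ℝ) + 1) * B ≤ B₁) {v : Fin n → EuclideanSpace ℝ (Fin n)}
    (hv : LinearIndependent ℝ v) (hvΛ : ∀ i, v i ∈ Λ) (hvB : ∀ i, v i ∈ cube n B)
    {D : Finset (EuclideanSpace ℝ (Fin n))} (hD : ∀ x, x ∈ D ↔ x ∈ Λ ∧ x ∈ cube n B₁) :
    (∏ i ∈ Finset.Icc 2 (n + 1), (zetaR i)⁻¹ - 1 / 4) * (D.card : ℝ) ^ (n + 1) ≤
      ((Fintype.piFinset fun _ : Fin (n + 1) => D).filter fun w =>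
        Submodule.span ℤ (Set.range v ∪ Set.range w) = Λ).card := by
  have : Nonempty (Fin n) := ⟨⟨0, hn⟩⟩
  let b := basisOfLinearIndependentOfCardEqFinrank hv (by simp)
  have hbv : ⇑b = v := coe_basisOfLinearIndependentOfCardEqFinrank hv (by simp)
  have hb : Submodule.span ℤ (Set.range b) ≤ Λ := by
    rw [hbv, Submodule.span_le]
    rintro _ ⟨i, rfl⟩
    exact hvΛ i
  have hbB : ∀ i, b i ∈ cube n B := fun i => hbv ▸ hvB i
  have hle : ((Fintype.piFinset fun _ : Fin (n + 1) => (finite_window Λ b B₁).toFinset).filter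
      fun w => AddSubgroup.closure (Set.range
        (((Submodule.span ℤ (Set.range b)).submoduleOf Λ).mkQ ∘ w)) = ⊤).card ≤
      ((Fintype.piFinset fun _ : Fin (n + 1) => D).filter fun w =>
        Submodule.span ℤ (Set.range v ∪ Set.range w) = Λ).card := by
    refine Finset.card_le_card_of_injOn (fun w i => (w i : EuclideanSpace ℝ (Fin n))) ?_ ?_
    · intro w hw
      simp only [Finset.coe_filter, Fintype.mem_piFinset, Set.Finite.mem_toFinset,
        Set.mem_ofPred_eq] at hw ⊢
      exact ⟨fun i => (hD _).2 ⟨(w i).2, hw.1 i (w i) rfl⟩, hbv ▸ span_union_range_eq Λ hb w hw.2⟩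
    · intro w _ w' _ h
      funext i
      exact Subtype.ext (congrFun h i)
  refine le_trans ?_ (Nat.cast_le.2 hle)
  refine le_trans ?_ (prod_inv_zetaR_mul_card_window_le Λ hb B₁)
  have hP := le_prod_inv_zetaR n
  have hP' := prod_inv_zetaR_le hn
  set P := ∏ i ∈ Finset.Icc 2 (n + 1), (zetaR i)⁻¹
  have hν := covRad_pos Λ hn
  have hn' : (1 : ℝ) ≤ n := by exact_mod_cast hn
  have hB0 : 0 < B := by linarith
  have hnB : 16 * n * B ≤ B₁ := by
    refine le_trans ?_ hB₁
    have : 16 * (n : ℝ) ≤ 8 * (n : ℝ) ^ 2 * ((n : ℝ) + 1) := by nlinarith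
    exact mul_le_mul_of_nonneg_right this hB0.le
  have hnB' : B ≤ n * B := by nlinarith
  have hD' := card_mul_cellVolume_le Λ (B := B₁) (S := D) (by linarith) hν.le fun l => (hD l).1
  have hW := pow_le_card_mul_cellVolume Λ (a := n * B) (b := B₁ - n * B) (by linarith)
    (S := (finite_window Λ b B₁).toFinset.map (Function.Embedding.subtype _)) (by
      intro l hl hli
      rw [Finset.mem_map]
      exact ⟨⟨l, hl⟩, (Set.Finite.mem_toFinset _).2 (mem_window Λ hbB hli), rfl⟩)
  rw [Finset.card_map] at hW
  set W := (finite_window Λ b B₁).toFinset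
  have hc := cellVolume_pos Λ
  have hnum := sub_mul_pow_le_mul_pow hn hν hB hB₁ (by linarith) hP'
  refine le_of_mul_le_mul_right ?_ (pow_pos hc (n + 1))
  rw [mul_assoc, mul_assoc, ← mul_pow, ← mul_pow]
  calc (P - 1 / 4) * (D.card * cellVolume Λ) ^ (n + 1)
      ≤ (P - 1 / 4) * ((B₁ + 2 * covRad Λ) ^ n) ^ (n + 1) :=
        mul_le_mul_of_nonneg_left (pow_le_pow_left₀ (by positivity) hD' _) (by linarith)
    _ ≤ P * ((B₁ - 2 * n * B - 2 * covRad Λ) ^ n) ^ (n + 1) := by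
        rw [← pow_mul, ← pow_mul]; exact hnum
    _ ≤ P * (W.card * cellVolume Λ) ^ (n + 1) := by
        refine mul_le_mul_of_nonneg_left (pow_le_pow_left₀ (pow_nonneg (by linarith) _) ?_ _)
          (by linarith)
        rwa [show B₁ - 2 * n * B - 2 * covRad Λ = B₁ - n * B - n * B - 2 * covRad Λ by ring]

end Window

section Concatenation

variable {V : Type*}

/-- Concatenation of an `n`-tuple and an `(n + 1)`-tuple. -/
def concat (n : ℕ) (p : (Fin n → V) × (Fin (n + 1) → V)) : Fin (2 * n + 1) → V :=
  Fin.append p.1 p.2 ∘ Fin.cast (by omega)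

theorem concat_bijective (n : ℕ) : Function.Bijective (concat (V := V) n) := by
  have h : (concat (V := V) n) =
      ((Fin.appendEquiv n (n + 1)).trans
        ((finCongr (show n + (n + 1) = 2 * n + 1 by omega)).arrowCongr (Equiv.refl V))) := rfl
  rw [h]
  exact Equiv.bijective _

theorem range_concat (n : ℕ) (p : (Fin n → V) × (Fin (n + 1) → V)) :
    Set.range (concat n p) = Set.range p.1 ∪ Set.range p.2 := by
  refine ((finCongr (show 2 * n + 1 = n + (n + 1) by omega)).surjective.range_comp
    (Fin.append p.1 p.2)).trans ?_
  ext x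
  rw [← not_iff_not]
  simp [Fin.forall_fin_add]

theorem forall_concat_iff (n : ℕ) (p : (Fin n → V) × (Fin (n + 1) → V)) (P Q R : V → Prop) :
    (∀ i : Fin (2 * n + 1), P (concat n p i) ∧ ((i : ℕ) < n → Q (concat n p i)) ∧
      (n ≤ (i : ℕ) → R (concat n p i))) ↔
    (∀ i, P (p.1 i) ∧ Q (p.1 i)) ∧ ∀ i, P (p.2 i) ∧ R (p.2 i) := by
  have h := (finCongr (show 2 * n + 1 = n + (n + 1) by omega)).forall_congr_left
    (p := fun i : Fin (2 * n + 1) => P (concat n p i) ∧ ((i : ℕ) < n → Q (concat n p i)) ∧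
      (n ≤ (i : ℕ) → R (concat n p i)))
  rw [h, Fin.forall_fin_add]
  simp [concat]

end Concatenation

theorem main_theorem (n : ℕ) (hn : 1 ≤ n) (Λ : Submodule ℤ (EuclideanSpace ℝ (Fin n)))
    [DiscreteTopology Λ] [IsZLattice ℝ Λ] (B B₁ : ℝ)
    (hB : B ≥ 8 * (n : ℝ) ^ ((n : ℝ) / 2) * covRad Λ)
    (hB₁ : B₁ ≥ 8 * (n : ℝ) ^ 2 * ((n : ℝ) + 1) * B)
    (X : Set (Fin (2 * n + 1) → EuclideanSpace ℝ (Fin n)))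
    (hX : X = {v | ∀ i : Fin (2 * n + 1), v i ∈ Λ ∧
      ((i : ℕ) < n → v i ∈ cube n B) ∧ (n ≤ (i : ℕ) → v i ∈ cube n B₁)})
    (Z : Set (Fin (2 * n + 1) → EuclideanSpace ℝ (Fin n)))
    (hZ : Z = {v ∈ X | Submodule.span ℤ (Set.range v) = Λ})
    (α : ℝ)
    (hα : α = (∏ i ∈ Finset.Icc 2 (n + 1), (zetaR i)⁻¹ - 1 / 4) *
      ∏ k ∈ Finset.range n,
        (1 - (n : ℝ) ^ ((k : ℝ) / 2) * (4 * (n : ℝ) ^ ((n : ℝ) / 2) + 1) ^ k /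
          (4 * (n : ℝ) ^ ((n : ℝ) / 2) - 1) ^ n)) :
    (Z.ncard : ℝ) ≥ α * X.ncard ∧ α ≥ 0.092 := by
  classical
  replace hα : α = (∏ i ∈ Finset.Icc 2 (n + 1), (zetaR i)⁻¹ - 1 / 4) *
    ∏ k ∈ Finset.range n, (1 - subspaceProportion n k) := hα
  have hP := le_prod_inv_zetaR n
  have hQ := le_prod_one_sub_subspaceProportion hn
  refine ⟨?_, by rw [hα]; nlinarith⟩
  rw [natCast_rpow_half] at hB
  have hν := covRad_pos Λ hn
  have hB8 : 8 * covRad Λ ≤ B := by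
    have : 1 ≤ √(n : ℝ) ^ n := one_le_pow₀ (one_le_sqrt_natCast hn)
    nlinarith
  let D (r : ℝ) : Finset (EuclideanSpace ℝ (Fin n)) :=
    (finite_inter_coe_of_isBounded Λ (isBounded_cube n r)).toFinset
  have hD : ∀ r x, x ∈ D r ↔ x ∈ Λ ∧ x ∈ cube n r := fun r x => by
    simp only [D, Set.Finite.mem_toFinset, Set.mem_inter_iff, SetLike.mem_coe, and_comm]
  let T := (Fintype.piFinset fun _ : Fin n => D B) ×ˢ Fintype.piFinset fun _ : Fin (n + 1) => D B₁
  have hmem : ∀ p, concat n p ∈ X ↔ p ∈ T := fun p => by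
    rw [hX, Set.mem_ofPred_eq,
      forall_concat_iff n p (· ∈ Λ) (· ∈ cube n B) (· ∈ cube n B₁)]
    simp only [T, Finset.mem_product, Fintype.mem_piFinset, hD]
  have hXT : X = concat n '' T := by
    ext x
    obtain ⟨p, rfl⟩ := (concat_bijective n).2 x
    rw [hmem, (concat_bijective n).1.mem_set_image, Finset.mem_coe]
  have hZT : Z = concat n '' (T.filter fun p =>
      Submodule.span ℤ (Set.range p.1 ∪ Set.range p.2) = Λ) := by
    ext x
    obtain ⟨p, rfl⟩ := (concat_bijective n).2 x
    rw [hZ, (concat_bijective n).1.mem_set_image, Finset.mem_coe, Finset.mem_filter,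
      Set.mem_ofPred_eq, hmem, range_concat]
  rw [hXT, hZT, Set.ncard_image_of_injective _ (concat_bijective n).1,
    Set.ncard_image_of_injective _ (concat_bijective n).1, Set.ncard_coe_finset,
    Set.ncard_coe_finset, Finset.card_product, Fintype.card_piFinset_const,
    Fintype.card_piFinset_const, ge_iff_le]
  push_cast
  let L := (Fintype.piFinset fun _ : Fin n => D B).filter fun v => LinearIndependent ℝ v
  have hL : (∏ k ∈ Finset.range n, (1 - subspaceProportion n k)) * ((D B).card : ℝ) ^ n ≤ L.card :=
    prod_mul_pow_le_card_linearIndependent (D B) (subspaceProportion n)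
      (fun k hk => subspaceProportion_le_one hk) fun k hk v =>
        card_span_le_subspaceProportion Λ hn hB hk v
          (fun l hl => by
            rw [Finset.mem_filter, hD] at hl
            exact ⟨hl.1.1, hl.1.2, hl.2⟩)
          (fun l hl hlB => (hD B l).2 ⟨hl, hlB⟩)
  have hsub : (L.sigma fun v => (Fintype.piFinset fun _ : Fin (n + 1) => D B₁).filter fun w =>
      Submodule.span ℤ (Set.range v ∪ Set.range w) = Λ).card ≤
      (T.filter fun p => Submodule.span ℤ (Set.range p.1 ∪ Set.range p.2) = Λ).card := by
    refine Finset.card_le_card_of_injOn (fun x => (x.1, x.2)) ?_ ?_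
    · rintro ⟨v, w⟩ h
      simp only [L, Finset.coe_sigma, Set.mem_sigma_iff, Finset.mem_coe, Finset.mem_filter] at h
      simp only [T, Finset.mem_coe, Finset.mem_filter, Finset.mem_product]
      exact ⟨⟨h.1.1, h.2.1⟩, h.2.2⟩
    · rintro ⟨v, w⟩ _ ⟨v', w'⟩ _ h
      obtain ⟨rfl, rfl⟩ := Prod.mk.inj h
      rfl
  refine le_trans ?_ (Nat.cast_le.2 hsub)
  rw [Finset.card_sigma, Nat.cast_sum]
  calc α * (((D B).card : ℝ) ^ n * ((D B₁).card : ℝ) ^ (n + 1))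
      = ((∏ k ∈ Finset.range n, (1 - subspaceProportion n k)) * ((D B).card : ℝ) ^ n) *
        ((∏ i ∈ Finset.Icc 2 (n + 1), (zetaR i)⁻¹ - 1 / 4) * ((D B₁).card : ℝ) ^ (n + 1)) := by
          rw [hα]; ring
    _ ≤ L.card *
        ((∏ i ∈ Finset.Icc 2 (n + 1), (zetaR i)⁻¹ - 1 / 4) * ((D B₁).card : ℝ) ^ (n + 1)) :=
          mul_le_mul_of_nonneg_right hL (mul_nonneg (by linarith) (by positivity))
    _ = ∑ _v ∈ L, (∏ i ∈ Finset.Icc 2 (n + 1), (zetaR i)⁻¹ - 1 / 4) *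
        ((D B₁).card : ℝ) ^ (n + 1) := by rw [Finset.sum_const, nsmul_eq_mul]
    _ ≤ _ := by
          refine Finset.sum_le_sum fun v hv => ?_
          simp only [L, Finset.mem_filter, Fintype.mem_piFinset, hD] at hv
          exact sub_mul_pow_le_card_generating Λ hn hB8 hB₁ hv.2 (fun i => (hv.1 i).1)
            (fun i => (hv.1 i).2) (hD B₁)
end

section
/- Let p be a prime and let H be a finite abelian p-group that can be generated by n elements. Then the number of (n+1)-tuples (h₁,…,h_{n+1}) ∈ H^{n+1} with ⟨h₁,…,h_{n+1}⟩ = H is at least (∏_{i=2}^{n+1} (1 − p^{-i})) · |H|^{n+1}. -/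
theorem span_range_eq_top_iff_linearIndependent_coords {K V : Type*} [Field K] [AddCommGroup V]
    [Module K V] {d m : ℕ} (b : Module.Basis (Fin d) K V) (v : Fin m → V) :
    Submodule.span K (Set.range v) = ⊤ ↔ LinearIndependent K (fun i j => b.repr (v j) i) := by
  have hfin : Module.Finite K V := Module.Finite.of_basis b
  let A : Matrix (Fin d) (Fin m) K := Matrix.of fun i j => b.repr (v j) i
  have hcols : Set.range A.col = b.equivFun '' Set.range v := by
    rw [← Set.range_comp]
    rfl
  have hspan : A.rank = Module.finrank K (Submodule.span K (Set.range v)) := by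
    rw [A.rank_eq_finrank_span_cols, hcols, ← LinearEquiv.coe_coe, Submodule.span_image]
    exact LinearEquiv.finrank_map_eq b.equivFun _
  have hrow : A.rank = Module.finrank K (Submodule.span K (Set.range A.row)) :=
    A.rank_eq_finrank_span_row
  change _ ↔ LinearIndependent K A.row
  rw [linearIndependent_iff_card_eq_finrank_span, Set.finrank, ← hrow, hspan,
    ← Module.finrank_eq_card_basis b]
  exact ⟨fun h => by rw [h, finrank_top], fun h => Submodule.eq_top_of_finrank_eq h.symm⟩

theorem natCard_span_range_eq_top {K V : Type*} [Field K] [Fintype K] [AddCommGroup V]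
    [Module K V] [Module.Finite K V] {m : ℕ} (hm : Module.finrank K V ≤ m) :
    Nat.card {v : Fin m → V // Submodule.span K (Set.range v) = ⊤} =
      ∏ i : Fin (Module.finrank K V), (Fintype.card K ^ m - Fintype.card K ^ (i : ℕ)) := by
  have hcard := card_linearIndependent (K := K) (V := Fin m → K) (k := Module.finrank K V)
    (by simpa using hm)
  rw [Module.finrank_fin_fun] at hcard
  rw [← hcard]
  let b := Module.finBasis K V
  refine Nat.card_congr (Equiv.subtypeEquiv
    ((Equiv.piCongrRight fun _ => b.equivFun.toEquiv).trans (Equiv.piComm _)) fun v => ?_)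
  exact span_range_eq_top_iff_linearIndependent_coords b v

theorem prod_one_sub_inv_pow_le {p : ℕ} (hp : 1 < p) {d n : ℕ} (hd : d ≤ n) :
    (∏ i ∈ Finset.Icc 2 (n + 1), (1 - 1 / (p : ℝ) ^ i)) * ((p : ℝ) ^ d) ^ (n + 1) ≤
      ((∏ i : Fin d, (p ^ (n + 1) - p ^ (i : ℕ)) : ℕ) : ℝ) := by
  have hp0 : (0 : ℝ) < p := by positivity
  have hp1 : (1 : ℝ) ≤ p := by exact_mod_cast hp.le
  have hnonneg (i : ℕ) : 0 ≤ 1 - 1 / (p : ℝ) ^ i :=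
    sub_nonneg.2 (div_le_one_of_le₀ (one_le_pow₀ hp1) (by positivity))
  have hfactor (i : ℕ) (hi : i ∈ Finset.range d) : ((p ^ (n + 1) - p ^ i : ℕ) : ℝ) =
      (1 - 1 / (p : ℝ) ^ (n + 1 - i)) * (p : ℝ) ^ (n + 1) := by
    have hi' : i ≤ n + 1 := by have := Finset.mem_range.1 hi; omega
    rw [Nat.cast_sub (Nat.pow_le_pow_right hp.le hi')]
    push_cast
    rw [sub_mul, one_mul, pow_sub₀ _ hp0.ne' hi']
    field_simp
  rw [Fin.prod_univ_eq_prod_range (fun i => p ^ (n + 1) - p ^ i) d, Nat.cast_prod,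
    Finset.prod_congr rfl hfactor, Finset.prod_mul_distrib, Finset.prod_const, Finset.card_range,
    pow_right_comm]
  gcongr
  rw [← Finset.prod_image (f := fun i => 1 - 1 / (p : ℝ) ^ i) (g := fun i => n + 1 - i)
    (s := Finset.range d)]
  · refine Finset.prod_le_prod_of_subset_of_le_one (fun j hj => ?_) (fun i _ => hnonneg i)
      fun i _ _ => sub_le_self _ (by positivity)
    obtain ⟨i, hi, rfl⟩ := Finset.mem_image.1 hj
    rw [Finset.mem_range] at hi
    rw [Finset.mem_Icc]
    omega
  · intro i hi j hj h
    simp only [Finset.coe_range, Set.mem_Iio] at hi hj h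
    omega

theorem Subgroup.eq_top_of_sup_range_powMonoidHom {p : ℕ} [Fact p.Prime] {H : Type*}
    [CommGroup H] [Finite H] (hH : IsPGroup p H) {K : Subgroup H} (hK : K ⊔ (powMonoidHom p : H →* H).range = ⊤) :
    K = ⊤ := by
  have key (j : ℕ) : ∀ h : H, ∃ k ∈ K, ∃ g : H, k * g ^ p ^ j = h := by
    induction j with
    | zero => exact fun h => ⟨1, K.one_mem, h, by simp⟩
    | succ j ih =>
      intro h
      obtain ⟨k, hk, g, rfl⟩ := ih h
      obtain ⟨k', hk', _, ⟨g', rfl⟩, rfl⟩ := Subgroup.mem_sup.1 (hK ▸ Subgroup.mem_top g)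
      refine ⟨k * k' ^ p ^ j, K.mul_mem hk (K.pow_mem hk' _), g', ?_⟩
      rw [powMonoidHom_apply, mul_pow, ← pow_mul, pow_succ', mul_assoc]
  obtain ⟨e, he⟩ := IsPGroup.iff_card.1 hH
  refine (Subgroup.eq_top_iff' K).2 fun h => ?_
  obtain ⟨k, hk, g, rfl⟩ := key e h
  rwa [← he, pow_card_eq_one', mul_one]

theorem Subgroup.closure_range_eq_top_iff_closure_range_mk_eq_top {p : ℕ} [Fact p.Prime]
    {H : Type*} [CommGroup H] [Finite H] (hH : IsPGroup p H) {ι : Type*} (v : ι → H) :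
    Subgroup.closure (Set.range v) = ⊤ ↔
      Subgroup.closure (Set.range fun i => (v i : H ⧸ (powMonoidHom p : H →* H).range)) = ⊤ := by
  set P := (powMonoidHom p : H →* H).range
  have hmap : Subgroup.closure (Set.range fun i => (v i : H ⧸ P)) =
      (Subgroup.closure (Set.range v)).map (QuotientGroup.mk' P) := by
    rw [MonoidHom.map_closure, ← Set.range_comp]
    rfl
  rw [hmap]
  constructor
  · intro h
    rw [h, ← MonoidHom.range_eq_map, QuotientGroup.range_mk']
  · intro h
    apply Subgroup.eq_top_of_sup_range_powMonoidHom hH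
    have := Subgroup.comap_map_eq (QuotientGroup.mk' P) (Subgroup.closure (Set.range v))
    rw [h, Subgroup.comap_top, QuotientGroup.ker_mk'] at this
    exact this.symm

theorem Subgroup.natCard_pi_quotient_mk {H : Type*} [Group H] (P : Subgroup H) (m : ℕ)
    (S : (Fin m → H ⧸ P) → Prop) :
    Nat.card {v : Fin m → H // S fun i => v i} =
      Nat.card {w : Fin m → H ⧸ P // S w} * Nat.card P ^ m := by
  let e : (Fin m → H) ≃ (Fin m → H ⧸ P) × (Fin m → P) :=
    (Equiv.piCongrRight fun _ => Subgroup.groupEquivQuotientProdSubgroup).trans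
      (Equiv.arrowProdEquivProdArrow _ _ _)
  have he (v : Fin m → H) : (e v).1 = fun i => (v i : H ⧸ P) := rfl
  calc Nat.card {v : Fin m → H // S fun i => v i}
      = Nat.card {x : (Fin m → H ⧸ P) × (Fin m → P) // S x.1} :=
        Nat.card_congr (e.subtypeEquiv fun v => by rw [he])
    _ = Nat.card ({w : Fin m → H ⧸ P // S w} × (Fin m → P)) :=
        Nat.card_congr (Equiv.prodSubtypeFstEquivSubtypeProd)
    _ = _ := by rw [Nat.card_prod, Nat.card_fun, Nat.card_fin]

theorem AddSubgroup.toZModSubmodule_closure {p : ℕ} {M : Type*} [AddCommGroup M]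
    [Module (ZMod p) M] (s : Set M) :
    AddSubgroup.toZModSubmodule p (AddSubgroup.closure s) = Submodule.span (ZMod p) s :=
  le_antisymm
    (show AddSubgroup.closure s ≤ (Submodule.span (ZMod p) s).toAddSubgroup from
      (AddSubgroup.closure_le _).2 Submodule.subset_span)
    (Submodule.span_le.2 AddSubgroup.subset_closure)

theorem Subgroup.closure_range_eq_top_iff_span_eq_top {p : ℕ} {V ι : Type*} [CommGroup V]
    [Module (ZMod p) (Additive V)] (v : ι → V) :
    Subgroup.closure (Set.range v) = ⊤ ↔
      Submodule.span (ZMod p) (Set.range fun i => Additive.ofMul (v i)) = ⊤ := by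
  rw [← Subgroup.toAddSubgroup.injective.eq_iff, Subgroup.toAddSubgroup_closure,
    ← (AddSubgroup.toZModSubmodule p).injective.eq_iff, AddSubgroup.toZModSubmodule_closure,
    map_top, map_top]
  rfl

/-- The case of an elementary abelian group. -/
theorem natCard_generating_tuples_ge_of_zmodModule {p : ℕ} [Fact p.Prime] {n : ℕ} {V : Type*}
    [CommGroup V] [Finite V] [Module (ZMod p) (Additive V)]
    (hgen : ∃ g : Fin n → V, Subgroup.closure (Set.range g) = ⊤) :
    (∏ i ∈ Finset.Icc 2 (n + 1), (1 - 1 / (p : ℝ) ^ i)) * (Nat.card V : ℝ) ^ (n + 1) ≤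
      Nat.card {v : Fin (n + 1) → V // Subgroup.closure (Set.range v) = ⊤} := by
  have hrank : Module.finrank (ZMod p) (Additive V) ≤ n := by
    obtain ⟨g, hg⟩ := hgen
    rw [Subgroup.closure_range_eq_top_iff_span_eq_top (p := p)] at hg
    have hle := finrank_range_le_card (R := ZMod p) fun i => Additive.ofMul (g i)
    rwa [Set.finrank, hg, finrank_top, Fintype.card_fin] at hle
  have hcard : Nat.card V = p ^ Module.finrank (ZMod p) (Additive V) := by
    rw [← Nat.card_congr (Additive.toMul (α := V)),
      Module.natCard_eq_pow_finrank (K := ZMod p), Nat.card_zmod]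
  have hcount := natCard_span_range_eq_top (K := ZMod p) (V := Additive V)
    (hrank.trans n.le_succ)
  rw [ZMod.card] at hcount
  have hcongr := Nat.card_congr (Equiv.subtypeEquiv
    (q := fun w => Submodule.span (ZMod p) (Set.range w) = ⊤)
    (Equiv.piCongrRight fun _ : Fin (n + 1) => Additive.ofMul)
    (Subgroup.closure_range_eq_top_iff_span_eq_top (p := p) (V := V)))
  rw [hcongr, hcount, hcard, Nat.cast_pow]
  exact prod_one_sub_inv_pow_le (Fact.out : p.Prime).one_lt hrank

theorem gen_finite_abelian_p_group (p : ℕ) (hp : p.Prime) (n : ℕ)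
    (H : Type*) [CommGroup H] [Fintype H] (hpgroup : IsPGroup p H)
    (hgen : ∃ g : Fin n → H, Subgroup.closure (Set.range g) = ⊤) :
    ((Nat.card {v : Fin (n + 1) → H // Subgroup.closure (Set.range v) = ⊤}) : ℝ) ≥
      (∏ i ∈ Finset.Icc 2 (n + 1), (1 - 1 / (p : ℝ) ^ i)) * (Fintype.card H : ℝ) ^ (n + 1) := by
  have : Fact p.Prime := ⟨hp⟩
  let P := (powMonoidHom p : H →* H).range
  have hquot : ∀ x : H ⧸ P, x ^ p = 1 := by
    intro x
    induction x using QuotientGroup.induction_on with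
    | H h => exact (QuotientGroup.eq_one_iff (h ^ p)).2 ⟨h, rfl⟩
  let _ : Module (ZMod p) (Additive (H ⧸ P)) := AddCommGroup.zmodModule hquot
  have hge := natCard_generating_tuples_ge_of_zmodModule (p := p) (n := n) (V := H ⧸ P) <| by
    obtain ⟨g, hg⟩ := hgen
    exact ⟨_, (Subgroup.closure_range_eq_top_iff_closure_range_mk_eq_top hpgroup g).1 hg⟩
  rw [ge_iff_le, ← Nat.card_eq_fintype_card, P.card_eq_card_quotient_mul_card_subgroup,
    Nat.card_congr (Equiv.subtypeEquivRight
      (Subgroup.closure_range_eq_top_iff_closure_range_mk_eq_top hpgroup)),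
    P.natCard_pi_quotient_mk (n + 1) fun w => Subgroup.closure (Set.range w) = ⊤]
  push_cast
  rw [mul_pow, ← mul_assoc]
  gcongr
end
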